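/- arXiv:2101.01879 — 3 statements merged into one kernel-verified Lean document; each statement's English description precedes it below -/
import Mathlib

section
/- (Serre, Corollaire 1) Let p be an odd prime and m ≥ 0 an integer. Let F = Σ_{n≥0} c_n qⁿ ∈ ℚ_p[[q]] be a p-adic modular form: there is a sequence (f_i) of modular forms of level 1 with rational q-expansions and weights k_i such that sup_n ‖a_n(f_i) − c_n‖_p → 0 as i → ∞. Suppose there is a residue r with r ≢ 0 (mod (p−1)·p^m) such that k_i ≡ r (mod (p−1)·p^m) for all sufficiently large i (i.e., the weight of F has nonzero image in ℤ/(p−1)p^mℤ). Then for every real number B, if ‖c_n‖_p ≤ B for all n ≥ 1, then ‖c_0‖_p ≤ p^m·B; equivalently, v_p(c_0) + m ≥ inf_{n≥1} v_p(c_n). -/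
/-- A level-1 modular form `f` of weight `k` has rational `q`-expansion with
coefficients `a : ℕ → ℚ` if `f(τ) = Σ_{n≥0} a_n·qⁿ` with `q = exp(2πiτ)` for all
`τ` in the upper half plane. -/
def HasRationalQExpansion {k : ℤ} (f : ModularForm (CongruenceSubgroup.Gamma 1) k)
    (a : ℕ → ℚ) : Prop :=
  ∀ τ : UpperHalfPlane,
    HasSum (fun n : ℕ =>
      (a n : ℂ) * Complex.exp (2 * Real.pi * Complex.I * n * (τ : ℂ))) (f τ)

section

open UpperHalfPlane hiding I
open Complex
open scoped Manifold MatrixGroups ModularForm Topology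

namespace SerreCor

/-- F is given by the q-expansion c. -/
def HasQ (F : ℍ → ℂ) (c : PowerSeries ℂ) : Prop :=
  ∀ τ : ℍ, HasSum (fun n : ℕ => c.coeff n * Function.Periodic.qParam 1 τ ^ n) (F τ)

lemma HasQ.add {F G : ℍ → ℂ} {c d : PowerSeries ℂ} (hF : HasQ F c) (hG : HasQ G d) :
    HasQ (F + G) (c + d) := fun τ => by
  simpa [add_mul] using (hF τ).add (hG τ)

lemma HasQ.sub {F G : ℍ → ℂ} {c d : PowerSeries ℂ} (hF : HasQ F c) (hG : HasQ G d) :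
    HasQ (F - G) (c - d) := fun τ => by
  simpa [sub_mul] using (hF τ).sub (hG τ)

lemma HasQ.smul {F : ℍ → ℂ} {c : PowerSeries ℂ} (a : ℂ) (hF : HasQ F c) :
    HasQ (a • F) (a • c) := fun τ => by
  simpa [mul_assoc] using (hF τ).mul_left a

lemma HasQ.mul {F G : ℍ → ℂ} {c d : PowerSeries ℂ} (hF : HasQ F c) (hG : HasQ G d) :
    HasQ (F * G) (c * d) := fun τ => by
  have h1 := (hF τ).summable.norm
  have h2 := (hG τ).summable.norm
  have h3 := summable_norm_sum_mul_antidiagonal_of_summable_norm h1 h2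
  have h4 := tsum_mul_tsum_eq_tsum_sum_antidiagonal_of_summable_norm h1 h2
  rw [(hF τ).tsum_eq, (hG τ).tsum_eq] at h4
  have h5 := h3.of_norm.hasSum
  rw [← h4] at h5
  convert! h5 using 2 with n
  rw [PowerSeries.coeff_mul, Finset.sum_mul]
  refine Finset.sum_congr rfl fun x hx => ?_
  have hx' : x.1 + x.2 = n := by simpa using hx
  rw [← hx', pow_add]; ring

lemma HasQ.const (a : ℂ) : HasQ (fun _ => a) (PowerSeries.C a) := fun τ => by
  convert! hasSum_ite_eq 0 a using 2 with n
  by_cases h : n = 0 <;> simp [h, PowerSeries.coeff_C]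

lemma HasQ.periodic {F : ℍ → ℂ} {c : PowerSeries ℂ} (hF : HasQ F c) :
    Function.Periodic (F ∘ ofComplex) (1 : ℝ) := by
  intro w
  by_cases hw : 0 < w.im
  · have hw' : 0 < (w + (1:ℝ)).im := by simpa using hw
    simp only [Function.comp_apply]
    rw [ofComplex_apply_of_im_pos hw, ofComplex_apply_of_im_pos hw']
    have h1 := hF ⟨w, hw⟩
    have h2 := hF ⟨w + (1:ℝ), hw'⟩
    refine HasSum.unique h2 ?_
    convert! h1 using 4 with n
    simp [Function.Periodic.qParam, mul_add, Complex.exp_add]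
  · have hw' : ¬ 0 < (w + (1:ℝ)).im := by simpa using hw
    simp only [Function.comp_apply]
    rw [ofComplex_apply_of_im_nonpos (not_lt.1 hw), ofComplex_apply_of_im_nonpos (not_lt.1 hw')]

lemma HasQ.bdd {F : ℍ → ℂ} {c : PowerSeries ℂ} (hF : HasQ F c) : IsBoundedAtImInfty F :=
  isBoundedAtImInfty_of_hasSum_qExpansion (c := fun n => c.coeff n) one_pos hF

lemma HasQ.eq {F : ℍ → ℂ} {c : PowerSeries ℂ} (hM : MDiff F) (hF : HasQ F c) :
    qExpansion 1 F = c := by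
  have hd := differentiableOn_cuspFunction_ball one_pos hF.periodic hM hF.bdd
  have ha : AnalyticAt ℂ (cuspFunction 1 F) 0 :=
    hd.analyticAt (Metric.isOpen_ball.mem_nhds (by simp))
  have h1 := (hasFPowerSeriesOnBall_cuspFunction (c := fun n => c.coeff n) one_pos ha hF).hasFPowerSeriesAt
  have h2 := ha.hasFPowerSeriesAt
  ext n
  have := congr_arg (FormalMultilinearSeries.coeff · n) (h1.eq_formalMultilinearSeries h2)
  simp only [FormalMultilinearSeries.coeff_ofScalars] at this
  rw [qExpansion_coeff, this]
  ring

lemma HasQ.unique {F : ℍ → ℂ} {c d : PowerSeries ℂ} (hM : MDiff F) (hF : HasQ F c) (hG : HasQ F d) :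
    c = d := by
  rw [← hF.eq hM, ← hG.eq hM]

/-- The operator q d/dq. -/
noncomputable def thetaC {R : Type*} [CommRing R] (c : PowerSeries R) : PowerSeries R :=
  PowerSeries.mk fun n => (n : R) * c.coeff n

lemma HasQ.D {F : ℍ → ℂ} {c : PowerSeries ℂ} (hM : MDiff F) (hF : HasQ F c) :
    HasQ (Derivative.normalizedDerivOfComplex F) (thetaC c) := fun τ => by
  have hd := differentiableOn_cuspFunction_ball one_pos hF.periodic hM hF.bdd
  have ha : AnalyticAt ℂ (cuspFunction 1 F) 0 :=
    hd.analyticAt (Metric.isOpen_ball.mem_nhds (by simp))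
  have hq : Function.Periodic.qParam 1 τ ∈ Metric.ball (0:ℂ) 1 := by
    simpa using UpperHalfPlane.norm_qParam_lt_one 1 τ
  have hc : ∀ n, c.coeff n = (n.factorial : ℂ)⁻¹ * iteratedDeriv n (cuspFunction 1 F) 0 := by
    intro n
    rw [← HasQ.eq hM hF, qExpansion_coeff]
  have hd' : DifferentiableOn ℂ (deriv (cuspFunction 1 F)) (Metric.ball 0 1) :=
    hd.deriv Metric.isOpen_ball
  have hs := Complex.hasSum_taylorSeries_on_ball hd' hq
  have hder : Derivative.normalizedDerivOfComplex F τ =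
      Function.Periodic.qParam 1 τ * deriv (cuspFunction 1 F) (Function.Periodic.qParam 1 τ) := by
    unfold Derivative.normalizedDerivOfComplex
    have he : (F ∘ ofComplex) =ᶠ[𝓝 (τ:ℂ)]
        fun w => cuspFunction 1 F (Function.Periodic.qParam 1 w) := by
      filter_upwards [isOpen_upperHalfPlaneSet.mem_nhds τ.im_pos] with w hw
      have := eq_cuspFunction (⟨w, hw⟩ : ℍ) one_ne_zero hF.periodic
      simp only [Function.comp_apply]
      rw [ofComplex_apply_of_im_pos hw, ← this]
    rw [he.deriv_eq]
    have h1 : HasDerivAt (cuspFunction 1 F) (deriv (cuspFunction 1 F) (Function.Periodic.qParam 1 τ))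
        (Function.Periodic.qParam 1 τ) :=
      ((hd _ hq).differentiableAt (Metric.isOpen_ball.mem_nhds hq)).hasDerivAt
    have h2 : HasDerivAt (Function.Periodic.qParam 1) (2 * Real.pi * I * Function.Periodic.qParam 1 τ) (τ:ℂ) := by
      have : Function.Periodic.qParam 1 = fun z : ℂ => Complex.exp (2 * Real.pi * I * z) := by
        ext z; simp [Function.Periodic.qParam]
      rw [this]
      have := ((hasDerivAt_id (τ:ℂ)).const_mul (2 * Real.pi * I)).cexp
      simpa [mul_comm] using this
    rw [show (fun w => cuspFunction 1 F (Function.Periodic.qParam 1 w)) = (cuspFunction 1 F) ∘ (Function.Periodic.qParam 1) from rfl, (h1.comp (τ:ℂ) h2).deriv]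
    have : (2 * Real.pi * I : ℂ) ≠ 0 := two_pi_I_ne_zero
    field_simp
  rw [hder, ← hasSum_nat_add_iff' 1]
  simp only [Finset.range_one, Finset.sum_singleton, thetaC, PowerSeries.coeff_mk, Nat.cast_zero, zero_mul, sub_zero]
  convert! hs.mul_left (Function.Periodic.qParam 1 τ) using 2 with n
  rw [hc, iteratedDeriv_succ', Nat.factorial_succ]
  have : (n.factorial:ℂ) ≠ 0 := by exact_mod_cast n.factorial_ne_zero
  have : ((n:ℂ)+1) ≠ 0 := by exact_mod_cast n.succ_ne_zero
  simp only [sub_zero, smul_eq_mul]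
  push_cast
  rw [pow_succ]
  field_simp

/-- Build a level one modular form. -/
noncomputable def mkForm (k : ℤ) (F : ℍ → ℂ) (c : PowerSeries ℂ) (hM : MDiff F)
    (hs : ∀ γ : SL(2, ℤ), F ∣[k] γ = F) (hF : HasQ F c) : ModularForm 𝒮ℒ k where
  toFun := F
  slash_action_eq' A hA := by
    obtain ⟨A, rfl⟩ := hA
    exact hs A
  holo' := hM
  bdd_at_cusps' hc := by
    rw [Subgroup.IsArithmetic.isCusp_iff_isCusp_SL2Z] at hc
    rw [OnePoint.isBoundedAt_iff_forall_SL2Z hc]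
    intro γ _
    rw [hs]
    exact hF.bdd

lemma hasQ_form {k : ℤ} (f : ModularForm 𝒮ℒ k) : HasQ f (qExpansion 1 f) := fun τ =>
  ModularForm.hasSum_qExpansion f one_pos one_mem_strictPeriods_SL τ

end SerreCor

end

section

open UpperHalfPlane hiding I
open Complex
open scoped Manifold MatrixGroups ModularForm Topology

namespace SerreCor

lemma eq_of_coeff_zero {k : ℤ} (hk : k < 12) {F G : ℍ → ℂ} {c d : PowerSeries ℂ} (hMF : MDiff F)
    (hMG : MDiff G) (hsF : ∀ γ : SL(2, ℤ), F ∣[k] γ = F) (hsG : ∀ γ : SL(2, ℤ), G ∣[k] γ = G)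
    (hF : HasQ F c) (hG : HasQ G d) (h0 : c.coeff 0 = d.coeff 0) : c = d := by
  let f := mkForm k F c hMF hsF hF
  let g := mkForm k G d hMG hsG hG
  have hq : qExpansion 1 (f - g : ModularForm 𝒮ℒ k) = c - d := by
    have : HasQ (f - g : ModularForm 𝒮ℒ k) (c - d) := HasQ.sub hF hG
    exact this.eq (hMF.sub hMG)
  have h : f - g = 0 := by
    apply ModularForm.sturm_bound_levelOne
    rw [hq]
    have : k.toNat / 12 = 0 := by omega
    rw [this]
    have h1 : ((1:ℕ) : ℕ∞) ≤ (c - d).order := by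
      apply PowerSeries.nat_le_order
      intro i hi
      have : i = 0 := by omega
      subst this
      rw [map_sub, h0, sub_self]
    exact lt_of_lt_of_le (by norm_num) h1
  rw [h] at hq
  have h2 : HasQ (0 : ModularForm 𝒮ℒ k) 0 := fun τ => by simp
  rw [h2.eq (ModularFormClass.holo (0 : ModularForm 𝒮ℒ k))] at hq
  exact (sub_eq_zero.1 hq.symm)

open EisensteinSeries Derivative ModularForm

lemma hasDerivAt_cocycle (γ : SL(2, ℤ)) (z : ℍ) :
    HasDerivAt ((D2 γ) ∘ ofComplex) (-(2 * Real.pi * I) * ((γ 1 0 : ℂ) / denom γ z) ^ 2) z := by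
  have h1 := (hasDerivAt_denom_zpow (γ : GL (Fin 2) ℝ) (-1) z).const_mul (2 * Real.pi * I * (γ 1 0 : ℂ))
  have he : ((D2 γ) ∘ ofComplex) =ᶠ[𝓝 (z:ℂ)]
      fun w => (2 * Real.pi * I * (γ 1 0 : ℂ)) * denom (γ : GL (Fin 2) ℝ) w ^ (-1 : ℤ) := by
    filter_upwards [isOpen_upperHalfPlaneSet.mem_nhds z.im_pos] with w hw
    simp only [Function.comp_apply]
    rw [ofComplex_apply_of_im_pos hw, D2]
    simp [div_eq_mul_inv]
  refine (h1.congr_of_eventuallyEq he).congr_deriv ?_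
  have hz := denom_ne_zero (γ : GL (Fin 2) ℝ) z
  have h3 : (-1 - 1 : ℤ) = -2 := by norm_num
  simp only [h3]
  rw [zpow_neg]
  have h5 : (((γ : GL (Fin 2) ℝ) 1 0 : ℝ) : ℂ) = (γ 1 0 : ℂ) := by simp
  rw [h5]
  have h6 : denom (γ : GL (Fin 2) ℝ) z ^ (2:ℤ) = denom (γ : GL (Fin 2) ℝ) z ^ 2 := by norm_cast
  rw [h6]
  push_cast
  field_simp

lemma ramP_slash (γ : SL(2, ℤ)) :
    (normalizedDerivOfComplex E2 - (1/12 : ℂ) • (E2 * E2)) ∣[(4:ℤ)] γ =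
      (normalizedDerivOfComplex E2 - (1/12 : ℂ) • (E2 * E2)) := by
  ext z
  have h1 := congrFun (normalizedDerivOfComplex_SL_slash (k := 2) E2_mdifferentiable (γ := γ)) z
  have h2 := congrFun (E2_slash_action γ) z
  have hM : MDiff (D2 γ) := fun z =>
    mdifferentiableAt_iff.2 (hasDerivAt_cocycle γ z).differentiableAt
  rw [E2_slash_action, normalizedDerivOfComplex_sub _ _ E2_mdifferentiable (hM.const_smul _),
    normalizedDerivOfComplex_smul _ _ hM] at h1
  have h3 := congrFun (ModularForm.mul_slash_SL2 2 2 γ E2 E2) z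
  rw [E2_slash_action] at h3
  have h4 : normalizedDerivOfComplex (D2 γ) z = - ((γ 1 0 : ℂ) / denom γ z) ^ 2 := by
    unfold normalizedDerivOfComplex
    rw [(hasDerivAt_cocycle γ z).deriv]
    have : (2 * Real.pi * I : ℂ) ≠ 0 := two_pi_I_ne_zero
    field_simp
  have h7 : D2 γ z = 2 * Real.pi * I * ((γ 1 0 : ℂ) / denom γ z) := by
    rw [D2]; ring
  have hlin : ((normalizedDerivOfComplex E2 - (1/12 : ℂ) • (E2 * E2)) ∣[(4:ℤ)] γ) z =
      (normalizedDerivOfComplex E2 ∣[(4:ℤ)] γ) z - (1/12:ℂ) * ((E2 * E2) ∣[(4:ℤ)] γ) z := by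
    simp only [ModularForm.SL_slash_apply, Pi.sub_apply, Pi.smul_apply, smul_eq_mul]; ring
  rw [hlin]
  simp only [Pi.sub_apply, Pi.smul_apply, h4, smul_eq_mul, Pi.mul_apply, h7] at h1 h3 ⊢
  rw [show ((2:ℤ)+2) = 4 by norm_num] at h1 h3
  rw [h3]
  generalize (γ 1 0 : ℂ) / denom γ z = u at *
  have h8 : (normalizedDerivOfComplex E2 ∣[(4:ℤ)] γ) z = normalizedDerivOfComplex E2 z
     - 1 / (2 * riemannZeta 2) * -u ^ 2 + ((2:ℤ):ℂ) * (2 * Real.pi * I)⁻¹ * u * (E2 z - 1 / (2 * riemannZeta 2) * (2 * Real.pi * I * u)) := by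
    linear_combination -h1
  rw [h8, riemannZeta_two]
  have hI : I ≠ 0 := I_ne_zero
  have hpi : (Real.pi : ℂ) ≠ 0 := by exact_mod_cast Real.pi_ne_zero
  have hI2 : I ^ 2 = -1 := I_sq
  field_simp
  push_cast
  ring_nf
  linear_combination (-72 * Complex.I * u ^ 2 + 24 * Real.pi * u * E2 z) * hI2

open ArithmeticFunction

/-- normalized Eisenstein type series -/
noncomputable def eis (a : ℤ) (j : ℕ) : PowerSeries ℤ :=
  PowerSeries.mk fun n => if n = 0 then 1 else a * (ArithmeticFunction.sigma j n : ℤ)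

lemma coeff_eis (a : ℤ) (j n : ℕ) : (eis a j).coeff n =
    if n = 0 then 1 else a * (ArithmeticFunction.sigma j n : ℤ) := by
  simp [eis]

noncomputable def eP : PowerSeries ℤ := eis (-24) 1
noncomputable def eQ : PowerSeries ℤ := eis 240 3
noncomputable def eR : PowerSeries ℤ := eis (-504) 5

/-- base change to the complex numbers -/
noncomputable abbrev toC : PowerSeries ℤ →+* PowerSeries ℂ := PowerSeries.map (Int.castRingHom ℂ)

lemma hasQ_P : HasQ E2 (toC eP) := fun τ => by
  have := hasSum_qExpansion_E2 (z := τ)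
  convert! this using 2 with n
  simp only [toC, PowerSeries.coeff_map, eP, coeff_eis, smul_eq_mul]
  congr 1
  · split_ifs <;> simp
  · simp [Function.Periodic.qParam]

lemma qExp_E4 : qExpansion 1 E₄ = toC eQ := by
  ext n
  have := E_qExpansion_coeff (k := 4) (by norm_num) (by decide) n
  rw [show qExpansion 1 E₄ = qExpansion 1 (ModularForm.E (k := 4) (by norm_num)) from rfl, this]
  simp only [toC, PowerSeries.coeff_map, eQ, coeff_eis]
  have hb : bernoulli 4 = -1/30 := by
    rw [bernoulli_eq_bernoulli'_of_ne_one (by norm_num)]; exact bernoulli'_four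
  rw [hb]
  split_ifs <;> simp
  ring

lemma qExp_E6 : qExpansion 1 E₆ = toC eR := by
  ext n
  have := E_qExpansion_coeff (k := 6) (by norm_num) (by decide) n
  rw [show qExpansion 1 E₆ = qExpansion 1 (ModularForm.E (k := 6) (by norm_num)) from rfl, this]
  simp only [toC, PowerSeries.coeff_map, eR, coeff_eis]
  have hb : bernoulli 6 = 1/42 := by
    rw [bernoulli_eq_bernoulli'_of_ne_one (by norm_num)]; decide +kernel
  rw [hb]
  split_ifs <;> simp
  left; norm_num

lemma hasQ_Q : HasQ E₄ (toC eQ) := qExp_E4 ▸ hasQ_form E₄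
lemma hasQ_R : HasQ E₆ (toC eR) := qExp_E6 ▸ hasQ_form E₆

lemma slash_form {k : ℤ} (f : ModularForm 𝒮ℒ k) (γ : SL(2, ℤ)) : (f : ℍ → ℂ) ∣[k] γ = f :=
  f.slash_action_eq' _ ⟨γ, rfl⟩

lemma toC_theta (c : PowerSeries ℤ) : toC (thetaC c) = thetaC (toC c) := by
  ext n; simp [thetaC]

lemma toC_inj : Function.Injective toC := by
  apply PowerSeries.map_injective
  exact Int.cast_injective

lemma toC_smul (n : ℤ) (x : PowerSeries ℤ) : toC (PowerSeries.C n * x) = (n:ℂ) • toC x := by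
  rw [map_mul, PowerSeries.map_C, PowerSeries.smul_eq_C_mul]; rfl

lemma ram_serre {k : ℤ} {F : ℍ → ℂ} {c : PowerSeries ℂ} (hM : MDiff F) (hF : HasQ F c) :
    HasQ (serreDerivative k F) (thetaC c - (k * 12⁻¹ : ℂ) • (toC eP * c)) := by
  have := (HasQ.D hM hF).sub ((hasQ_P.mul hF).smul (k * 12⁻¹ : ℂ))
  convert! this using 1
  ext z
  simp [serreDerivative]; ring

lemma coeff0_eis (a : ℤ) (j : ℕ) : PowerSeries.constantCoeff (eis a j) = 1 := by
  rw [← PowerSeries.coeff_zero_eq_constantCoeff_apply, coeff_eis]; simp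

lemma coeff0_toC_eis (a : ℤ) (j : ℕ) : PowerSeries.constantCoeff (toC (eis a j)) = 1 := by
  rw [← PowerSeries.coeff_zero_eq_constantCoeff_apply, toC, PowerSeries.coeff_map, coeff_eis]; simp

lemma ram_Q : 3 * thetaC eQ = eP * eQ - eR := by
  apply toC_inj
  have h := eq_of_coeff_zero (k := 6) (by norm_num) (serreDerivative_mdifferentiable (4:ℤ) E₄.holo')
    (E₆.holo'.const_smul (-1/3 : ℂ)) (fun γ => serreDerivative_slash_invariant E₄.holo' (slash_form E₄ γ))
    (fun γ => by rw [ModularForm.SL_smul_slash]; exact congrArg _ (slash_form E₆ γ))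
    (ram_serre E₄.holo' hasQ_Q) (hasQ_R.smul _) (by
      simp [thetaC, eP, eQ, eR, coeff0_toC_eis, coeff0_eis] <;> norm_num)
  simp only [map_mul, map_sub, toC_theta, map_ofNat]
  rw [PowerSeries.smul_eq_C_mul, PowerSeries.smul_eq_C_mul] at h
  have h3 : (3 : PowerSeries ℂ) * PowerSeries.C (-1/3 : ℂ) = -1 := by
    rw [show (3 : PowerSeries ℂ) = PowerSeries.C 3 from (map_ofNat _ _).symm, ← map_mul]; norm_num
  have h4 : (3 : PowerSeries ℂ) * PowerSeries.C (((4:ℤ):ℂ) * 12⁻¹ : ℂ) = 1 := by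
    rw [show (3 : PowerSeries ℂ) = PowerSeries.C 3 from (map_ofNat _ _).symm, ← map_mul]; norm_num
  linear_combination 3 * h + toC eR * h3 + toC eP * toC eQ * h4

lemma ram_R : 2 * thetaC eR = eP * eR - eQ ^ 2 := by
  apply toC_inj
  have h := eq_of_coeff_zero (k := 8) (by norm_num) (serreDerivative_mdifferentiable (6:ℤ) E₆.holo')
    ((E₄.holo'.mul E₄.holo').const_smul (-1/2 : ℂ)) (fun γ => serreDerivative_slash_invariant E₆.holo' (slash_form E₆ γ))
    (fun γ => by
      rw [ModularForm.SL_smul_slash]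
      have := ModularForm.mul_slash_SL2 4 4 γ E₄ E₄
      rw [slash_form] at this
      exact congrArg _ this)
    (ram_serre E₆.holo' hasQ_R) ((hasQ_Q.mul hasQ_Q).smul _) (by
      simp [thetaC, eP, eQ, eR, coeff0_toC_eis, coeff0_eis] <;> norm_num)
  simp only [map_mul, map_sub, toC_theta, map_ofNat, map_pow]
  rw [PowerSeries.smul_eq_C_mul, PowerSeries.smul_eq_C_mul] at h
  have h3 : (2 : PowerSeries ℂ) * PowerSeries.C (-1/2 : ℂ) = -1 := by
    rw [show (2 : PowerSeries ℂ) = PowerSeries.C 2 from (map_ofNat _ _).symm, ← map_mul]; norm_num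
  have h4 : (2 : PowerSeries ℂ) * PowerSeries.C (((6:ℤ):ℂ) * 12⁻¹ : ℂ) = 1 := by
    rw [show (2 : PowerSeries ℂ) = PowerSeries.C 2 from (map_ofNat _ _).symm, ← map_mul]; norm_num
  linear_combination 2 * h + toC eQ * toC eQ * h3 + toC eP * toC eR * h4

lemma ram_P : 12 * thetaC eP = eP ^ 2 - eQ := by
  apply toC_inj
  have h := eq_of_coeff_zero (k := 4) (by norm_num)
    ((normalizedDerivOfComplex_mdifferentiable E2_mdifferentiable).sub
      ((E2_mdifferentiable.mul E2_mdifferentiable).const_smul (1/12 : ℂ)))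
    (E₄.holo'.const_smul (-1/12 : ℂ)) ramP_slash
    (fun γ => by rw [ModularForm.SL_smul_slash]; exact congrArg _ (slash_form E₄ γ))
    ((HasQ.D E2_mdifferentiable hasQ_P).sub ((hasQ_P.mul hasQ_P).smul (1/12:ℂ))) (hasQ_Q.smul _) (by
      simp [thetaC, eP, eQ, coeff0_toC_eis, coeff0_eis] <;> norm_num)
  simp only [map_mul, map_sub, toC_theta, map_ofNat, map_pow]
  rw [PowerSeries.smul_eq_C_mul, PowerSeries.smul_eq_C_mul] at h
  have h3 : (12 : PowerSeries ℂ) * PowerSeries.C (-1/12 : ℂ) = -1 := by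
    rw [show (12 : PowerSeries ℂ) = PowerSeries.C 12 from (map_ofNat _ _).symm, ← map_mul]; norm_num
  have h4 : (12 : PowerSeries ℂ) * PowerSeries.C (1/12 : ℂ) = 1 := by
    rw [show (12 : PowerSeries ℂ) = PowerSeries.C 12 from (map_ofNat _ _).symm, ← map_mul]; norm_num
  linear_combination 12 * h + toC eQ * h3 + toC eP * toC eP * h4

end SerreCor

end

section

open UpperHalfPlane hiding I
open Complex
open scoped Manifold MatrixGroups ModularForm Topology
open EisensteinSeries Derivative ModularForm

namespace SerreCor

/-- sum of sigma, no constant term -/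
noncomputable def sig (j : ℕ) : PowerSeries ℤ :=
  PowerSeries.mk fun n => (ArithmeticFunction.sigma j n : ℤ)

lemma eis_eq (a : ℤ) (j : ℕ) : eis a j = 1 + PowerSeries.C a * sig j := by
  ext n
  rw [coeff_eis, map_add, PowerSeries.coeff_C_mul, sig, PowerSeries.coeff_mk, PowerSeries.coeff_one]
  split_ifs with h <;> simp [h]

noncomputable def eD : PowerSeries ℤ :=
  PowerSeries.mk (fun n => ((5 * ArithmeticFunction.sigma 3 n + 7 * ArithmeticFunction.sigma 5 n : ℤ)) / 12)
    + 100 * sig 3 ^ 2 + 8000 * sig 3 ^ 3 - 147 * sig 5 ^ 2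

lemma twelve_dvd (n : ℕ) :
    (12 : ℤ) ∣ (5 * ArithmeticFunction.sigma 3 n + 7 * ArithmeticFunction.sigma 5 n : ℤ) := by
  simp only [ArithmeticFunction.sigma_apply]
  push_cast
  rw [Finset.mul_sum, Finset.mul_sum, ← Finset.sum_add_distrib]
  apply Finset.dvd_sum
  intro d _
  refine (ZMod.intCast_zmod_eq_zero_iff_dvd _ 12).1 ?_
  push_cast
  generalize (d : ZMod 12) = x
  revert x
  decide

lemma eD_eq : 1728 * eD = eQ ^ 3 - eR ^ 2 := by
  have h : 12 * PowerSeries.mk (fun n => ((5 * ArithmeticFunction.sigma 3 n + 7 * ArithmeticFunction.sigma 5 n : ℤ)) / 12) = 5 * sig 3 + 7 * sig 5 := by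
    ext n
    rw [show (12 : PowerSeries ℤ) = PowerSeries.C 12 from (map_ofNat _ _).symm,
      show (5 : PowerSeries ℤ) = PowerSeries.C 5 from (map_ofNat _ _).symm,
      show (7 : PowerSeries ℤ) = PowerSeries.C 7 from (map_ofNat _ _).symm]
    simp only [map_add, PowerSeries.coeff_C_mul, PowerSeries.coeff_mk, sig]
    exact Int.mul_ediv_cancel' (twelve_dvd n)
  rw [eD, eQ, eR, eis_eq, eis_eq,
    show PowerSeries.C (240:ℤ) = 240 from (map_ofNat _ _),
    show PowerSeries.C (-504:ℤ) = -504 by rw [map_neg]; exact congrArg _ (map_ofNat _ _)]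
  linear_combination 144 * h

lemma hasQ_D : HasQ discriminant (toC eD) := by
  have h1 : HasQ ((1/1728 : ℂ) • ((E₄ : ℍ → ℂ) * (E₄ * E₄) - (E₆ : ℍ → ℂ) * E₆)) ((1/1728 : ℂ) • (toC eQ * (toC eQ * toC eQ) - toC eR * toC eR)) :=
    ((hasQ_Q.mul (hasQ_Q.mul hasQ_Q)).sub (hasQ_R.mul hasQ_R)).smul _
  convert! h1 using 1
  · ext z
    rw [discriminant_eq_E₄_cube_sub_E₆_sq]
    simp; ring
  · have := congrArg toC eD_eq
    simp only [map_mul, map_sub, map_pow, map_ofNat] at this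
    rw [PowerSeries.smul_eq_C_mul]
    have h3 : (1728 : PowerSeries ℂ) * PowerSeries.C (1/1728 : ℂ) = 1 := by
      rw [show (1728 : PowerSeries ℂ) = PowerSeries.C 1728 from (map_ofNat _ _).symm, ← map_mul]; norm_num
    linear_combination PowerSeries.C (1/1728 : ℂ) * this - toC eD * h3

lemma qExp_D : qExpansion 1 discriminant = toC eD :=
  hasQ_D.eq CuspForm.discriminant.holo'

lemma eD_coeff_zero : PowerSeries.constantCoeff eD = 0 := by
  rw [eD]
  simp [sig]

lemma eD_coeff_one : PowerSeries.coeff 1 eD = 1 := by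
  have h : (1 : ℂ) = ((PowerSeries.coeff 1 eD : ℤ) : ℂ) := by
    rw [← discriminant_qExpansion_coeff_one, qExp_D]; simp
  exact_mod_cast h.symm

section structure_thm

variable {R : Type*} [CommRing R]

/-- base change from the integers -/
noncomputable abbrev fromZ (R : Type*) [CommRing R] : PowerSeries ℤ →+* PowerSeries R :=
  PowerSeries.map (Int.castRingHom R)

lemma exists_div_D (φ : PowerSeries R) (h0 : PowerSeries.constantCoeff φ = 0) :
    ∃ ψ, φ = fromZ R eD * ψ := by
  have hD : PowerSeries.constantCoeff (fromZ R eD) = 0 := by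
    rw [← PowerSeries.coeff_zero_eq_constantCoeff_apply, PowerSeries.coeff_map,
      PowerSeries.coeff_zero_eq_constantCoeff_apply, eD_coeff_zero]; simp
  obtain ⟨u, hu⟩ := PowerSeries.X_dvd_iff.2 hD
  obtain ⟨v, hv⟩ := PowerSeries.X_dvd_iff.2 h0
  have hu1 : PowerSeries.constantCoeff u = 1 := by
    have := congrArg (PowerSeries.coeff 1) hu
    rw [show 1 = 0 + 1 from rfl, PowerSeries.coeff_succ_X_mul, PowerSeries.coeff_map, eD_coeff_one] at this
    simpa using this.symm
  obtain ⟨w, hw⟩ := (PowerSeries.isUnit_iff_constantCoeff.2 (by rw [hu1]; exact isUnit_one) : IsUnit u)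
  refine ⟨↑w⁻¹ * v, ?_⟩
  rw [hv, hu, ← hw, mul_assoc, ← mul_assoc (w : PowerSeries R), Units.mul_inv, one_mul]

/-- power series which are q-expansions of modular forms -/
def IsMF (ι : R →+* ℂ) (k : ℕ) (φ : PowerSeries R) : Prop :=
  ∃ f : ModularForm 𝒮ℒ (k : ℤ), qExpansion 1 f = PowerSeries.map ι φ

variable {ι : R →+* ℂ}

lemma IsMF.sub {k : ℕ} {φ ψ : PowerSeries R} (h1 : IsMF ι k φ) (h2 : IsMF ι k ψ) : IsMF ι k (φ - ψ) := by
  obtain ⟨f, hf⟩ := h1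
  obtain ⟨g, hg⟩ := h2
  refine ⟨f - g, ?_⟩
  rw [map_sub, ← hf, ← hg]
  exact ModularForm.qExpansion_sub one_pos one_mem_strictPeriods_SL f g

lemma IsMF.smul {k : ℕ} {φ : PowerSeries R} (c : R) (h1 : IsMF ι k φ) : IsMF ι k (PowerSeries.C c * φ) := by
  obtain ⟨f, hf⟩ := h1
  refine ⟨ι c • f, ?_⟩
  rw [map_mul, ← hf, PowerSeries.map_C, ← PowerSeries.smul_eq_C_mul]
  exact ModularForm.qExpansion_smul one_pos one_mem_strictPeriods_SL (ι c) f

lemma IsMF.mul {k l : ℕ} {φ ψ : PowerSeries R} (h1 : IsMF ι k φ) (h2 : IsMF ι l ψ) : IsMF ι (k + l) (φ * ψ) := by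
  obtain ⟨f, hf⟩ := h1
  obtain ⟨g, hg⟩ := h2
  refine ⟨ModularForm.mcast (by push_cast; rfl) (f.mul g), ?_⟩
  rw [ModularForm.qExpansion_mcast, map_mul, ← hf, ← hg]
  exact ModularForm.qExpansion_mul one_pos one_mem_strictPeriods_SL f g

lemma IsMF.one : IsMF ι 0 1 := ⟨(1 : ModularForm 𝒮ℒ 0), by
  rw [map_one]; exact ModularForm.qExpansion_one⟩

lemma IsMF.pow {k : ℕ} {φ : PowerSeries R} (h1 : IsMF ι k φ) (n : ℕ) : IsMF ι (k * n) (φ ^ n) := by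
  induction n with
  | zero => simpa using IsMF.one
  | succ n ih => rw [pow_succ, mul_add, mul_one]; exact ih.mul h1

lemma map_fromZ (φ : PowerSeries ℤ) : PowerSeries.map ι (fromZ R φ) = toC φ := by
  ext n; simp

lemma IsMF.eQ : IsMF ι 4 (fromZ R SerreCor.eQ) := ⟨E₄, by rw [map_fromZ]; exact qExp_E4⟩
lemma IsMF.eR : IsMF ι 6 (fromZ R SerreCor.eR) := ⟨E₆, by rw [map_fromZ]; exact qExp_E6⟩

lemma coeff0_fromZ_eis (a : ℤ) (j : ℕ) : PowerSeries.constantCoeff (fromZ R (eis a j)) = 1 := by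
  rw [← PowerSeries.coeff_zero_eq_constantCoeff_apply, PowerSeries.coeff_map, coeff_eis]; simp

theorem induct_MF (hι : Function.Injective ι) (M : ℕ → PowerSeries R → Prop)
    (hz : ∀ k, M k 0) (hadd : ∀ k φ ψ, M k φ → M k ψ → M k (φ + ψ))
    (hmon : ∀ c a b, M (4 * a + 6 * b) (PowerSeries.C c * (fromZ R eQ ^ a * fromZ R eR ^ b)))
    (hD : ∀ k φ, M k φ → M (k + 12) (fromZ R eD * φ)) :
    ∀ k φ, IsMF ι k φ → M k φ := by
  have hinj : Function.Injective (PowerSeries.map ι) := PowerSeries.map_injective _ hι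
  intro k
  induction k using Nat.strong_induction_on with
  | _ k ih =>
  intro φ hφ
  have hzero : (∀ f : ModularForm 𝒮ℒ (k:ℤ), f = 0) → M k φ := by
    intro h
    obtain ⟨f, hf⟩ := hφ
    have : φ = 0 := hinj (by
      rw [← hf, map_zero, ModularForm.qExpansion_eq_zero_iff one_pos one_mem_strictPeriods_SL]; exact h f)
    rw [this]; exact hz k
  rcases Nat.even_or_odd k with he | ho
  swap
  · exact hzero (fun f => ModularForm.levelOne_odd_weight_eq_zero (by exact_mod_cast ho) f)
  by_cases h2 : k = 2
  · subst h2
    exact hzero (fun f => rank_zero_iff_forall_zero.mp (ModularForm.levelOne_weight_two_rank_zero) f)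
  obtain ⟨a, b, hab⟩ : ∃ a b, k = 4 * a + 6 * b := by
    obtain ⟨t, ht⟩ := he
    rcases Nat.even_or_odd' t with ⟨s, hs | hs⟩
    · exact ⟨s, 0, by omega⟩
    · exact ⟨s - 1, 1, by omega⟩
  set E := fromZ R eQ ^ a * fromZ R eR ^ b with hE
  have hEM : IsMF ι k E := by
    rw [hab]; exact (IsMF.eQ.pow a).mul (IsMF.eR.pow b)
  have hE0 : PowerSeries.constantCoeff E = 1 := by
    rw [hE, map_mul, map_pow, map_pow, eQ, eR, coeff0_fromZ_eis, coeff0_fromZ_eis]; simp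
  set φ' := φ - PowerSeries.C (PowerSeries.constantCoeff φ) * E with hφ'
  have hM' : IsMF ι k φ' := hφ.sub (hEM.smul _)
  have h0 : PowerSeries.constantCoeff φ' = 0 := by
    rw [hφ', map_sub, map_mul, hE0]; simp
  have key : M k φ' := by
    obtain ⟨f, hf⟩ := hM'
    have hf0 : (qExpansion 1 f).coeff 0 = 0 := by
      rw [hf, PowerSeries.coeff_map, PowerSeries.coeff_zero_eq_constantCoeff_apply, h0, map_zero]
    by_cases hk : k < 12
    · have : f = 0 := by
        apply ModularForm.sturm_bound_levelOne
        have : (k:ℤ).toNat / 12 = 0 := by omega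
        rw [this]
        have h1 : ((1:ℕ) : ℕ∞) ≤ (qExpansion 1 f).order := by
          apply PowerSeries.nat_le_order
          intro i hi
          have : i = 0 := by omega
          subst this
          exact hf0
        exact lt_of_lt_of_le (by norm_num) h1
      have : φ' = 0 := hinj (by
        rw [← hf, map_zero, ModularForm.qExpansion_eq_zero_iff one_pos one_mem_strictPeriods_SL]; exact this)
      rw [this]; exact hz k
    · obtain ⟨ψ, hψ⟩ := exists_div_D φ' h0
      have hq := qExpansion_eq_qExpansion_discriminant_mul f hf0
      have hk12 : k = (k - 12) + 12 := by omega
      rw [hψ, hk12]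
      apply hD
      apply ih _ (by omega)
      refine ⟨ModularForm.mcast (by omega) (CuspForm.discriminantEquiv (toCuspForm f hf0)), ?_⟩
      rw [ModularForm.qExpansion_mcast]
      rw [hf, hψ, map_mul, map_fromZ, qExp_D] at hq
      have hne : toC eD ≠ 0 := by
        intro h
        have := congrArg (PowerSeries.coeff 1) h
        rw [PowerSeries.coeff_map, eD_coeff_one] at this
        simp at this
      exact (mul_left_cancel₀ hne hq).symm
  have : φ = φ' + PowerSeries.C (PowerSeries.constantCoeff φ) * E := by rw [hφ']; ring
  rw [this]
  refine hadd _ _ _ key ?_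
  have := hmon (PowerSeries.constantCoeff φ) a b
  rwa [← hab] at this

end structure_thm

end SerreCor

end

section

namespace SerreCor

section theta
variable {R : Type*} [CommRing R]

lemma thetaC_eq (c : PowerSeries R) : thetaC c = PowerSeries.X * PowerSeries.derivative R c := by
  ext n
  cases n with
  | zero => simp [thetaC]
  | succ n => rw [PowerSeries.coeff_succ_X_mul, PowerSeries.coeff_derivative]; simp [thetaC]; ring

lemma thetaC_mul (c d : PowerSeries R) : thetaC (c * d) = thetaC c * d + c * thetaC d := by
  simp only [thetaC_eq, Derivation.leibniz, smul_eq_mul]; ring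

lemma thetaC_add (c d : PowerSeries R) : thetaC (c + d) = thetaC c + thetaC d := by
  simp only [thetaC_eq, map_add]; ring

lemma thetaC_C (c : R) : thetaC (PowerSeries.C c) = 0 := by
  ext n
  cases n with
  | zero => simp [thetaC]
  | succ n => simp [thetaC, PowerSeries.coeff_C]

lemma thetaC_fromZ (φ : PowerSeries ℤ) : fromZ R (thetaC φ) = thetaC (fromZ R φ) := by
  ext n; simp [thetaC]

lemma coeff0_thetaC (c : PowerSeries R) : PowerSeries.constantCoeff (thetaC c) = 0 := by
  rw [thetaC_eq]; simp

lemma ramK_Q : 3 * thetaC (fromZ R eQ) = fromZ R eP * fromZ R eQ - fromZ R eR := by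
  have := congrArg (fromZ R) ram_Q
  simpa only [map_mul, map_sub, map_ofNat, thetaC_fromZ] using this

lemma ramK_R : 2 * thetaC (fromZ R eR) = fromZ R eP * fromZ R eR - fromZ R eQ ^ 2 := by
  have := congrArg (fromZ R) ram_R
  simpa only [map_mul, map_sub, map_ofNat, thetaC_fromZ, map_pow] using this

lemma ramK_P : 12 * thetaC (fromZ R eP) = fromZ R eP ^ 2 - fromZ R eQ := by
  have := congrArg (fromZ R) ram_P
  simpa only [map_mul, map_sub, map_ofNat, thetaC_fromZ, map_pow] using this

end theta

section alg
variable (K : Type*) [Field K]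

abbrev SP := MvPolynomial (Fin 2) K

variable {K}

noncomputable abbrev vQ : SP K := MvPolynomial.X 0
noncomputable abbrev vR : SP K := MvPolynomial.X 1

noncomputable def grd : SP K →ₐ[K] Polynomial (SP K) :=
  MvPolynomial.aeval ![Polynomial.C vQ * Polynomial.X ^ 4, Polynomial.C vR * Polynomial.X ^ 6]

lemma grd_Q : grd (vQ : SP K) = Polynomial.C vQ * Polynomial.X ^ 4 := by simp [grd]
lemma grd_R : grd (vR : SP K) = Polynomial.C vR * Polynomial.X ^ 6 := by simp [grd]
lemma grd_C (c : K) : grd (MvPolynomial.C c : SP K) = Polynomial.C (MvPolynomial.C c) := by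
  rw [← MvPolynomial.algebraMap_eq, AlgHom.commutes]; rfl

/-- isobaric of weight k -/
def Iso (k : ℕ) (g : SP K) : Prop := grd g = Polynomial.C g * Polynomial.X ^ k

lemma Iso.zero (k : ℕ) : Iso k (0 : SP K) := by simp [Iso]
lemma Iso.C (c : K) : Iso 0 (MvPolynomial.C c : SP K) := by rw [Iso, grd_C]; simp
lemma Iso.one : Iso 0 (1 : SP K) := by simp [Iso]
lemma Iso.vQ : Iso 4 (SerreCor.vQ : SP K) := grd_Q
lemma Iso.vR : Iso 6 (SerreCor.vR : SP K) := grd_R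
lemma Iso.add {k : ℕ} {g h : SP K} (hg : Iso k g) (hh : Iso k h) : Iso k (g + h) := by
  rw [Iso] at *; rw [map_add, hg, hh, map_add]; ring
lemma Iso.sub {k : ℕ} {g h : SP K} (hg : Iso k g) (hh : Iso k h) : Iso k (g - h) := by
  rw [Iso] at *; rw [map_sub, hg, hh, map_sub]; ring
lemma Iso.mul {k l : ℕ} {g h : SP K} (hg : Iso k g) (hh : Iso l h) : Iso (k + l) (g * h) := by
  rw [Iso] at *; rw [map_mul, hg, hh, map_mul]; ring
lemma Iso.smul {k : ℕ} {g : SP K} (c : K) (hg : Iso k g) : Iso k (MvPolynomial.C c * g) := by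
  simpa using (Iso.C c).mul hg
lemma Iso.pow {k : ℕ} {g : SP K} (hg : Iso k g) (n : ℕ) : Iso (k * n) (g ^ n) := by
  rw [Iso] at *; rw [map_pow, hg, map_pow, mul_pow, pow_mul]

lemma Iso.weight_unique {k l : ℕ} {g : SP K} (h0 : g ≠ 0) (hk : Iso k g) (hl : Iso l g) : k = l := by
  have h := hk.symm.trans hl
  have := congrArg Polynomial.natDegree h
  rwa [Polynomial.natDegree_C_mul_X_pow _ _ h0, Polynomial.natDegree_C_mul_X_pow _ _ h0] at this

lemma eval_grd (g : SP K) : Polynomial.eval 1 (grd g) = g := by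
  have : (Polynomial.evalRingHom (1 : SP K)).comp (grd : SP K →ₐ[K] Polynomial (SP K)).toRingHom = RingHom.id _ := by
    apply MvPolynomial.ringHom_ext
    · intro c
      simp only [RingHom.comp_apply]
      erw [grd_C]; simp
    · intro i
      fin_cases i
      · simp only [RingHom.comp_apply]; erw [grd_Q]; simp [vQ]
      · simp only [RingHom.comp_apply]; erw [grd_R]; simp [vR]
  exact congrFun (congrArg DFunLike.coe this) g

/-- factors of isobaric polynomials are isobaric -/
lemma Iso.factor {k : ℕ} {a b : SP K} (h0 : a * b ≠ 0) (h : Iso k (a * b)) :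
    ∃ i j, i + j = k ∧ Iso i a ∧ Iso j b := by
  have ha0 : a ≠ 0 := left_ne_zero_of_mul h0
  have hb0 : b ≠ 0 := right_ne_zero_of_mul h0
  have hga : grd a ≠ 0 := fun h => ha0 (by rw [← eval_grd a, h]; simp)
  have hgb : grd b ≠ 0 := fun h => hb0 (by rw [← eval_grd b, h]; simp)
  have hm : grd a * grd b = Polynomial.C (a * b) * Polynomial.X ^ k := by rw [← map_mul]; exact h
  have h1 : (grd a).natDegree + (grd b).natDegree = k := by
    rw [← Polynomial.natDegree_mul hga hgb, hm, Polynomial.natDegree_C_mul_X_pow _ _ h0]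
  have h2 : (grd a).natTrailingDegree + (grd b).natTrailingDegree = k := by
    rw [← Polynomial.natTrailingDegree_mul hga hgb, hm, Polynomial.C_mul_X_pow_eq_monomial,
      Polynomial.natTrailingDegree_monomial h0]
  have h3 := Polynomial.natTrailingDegree_le_natDegree (grd a)
  have h4 := Polynomial.natTrailingDegree_le_natDegree (grd b)
  have key : ∀ g : SP K, (grd g).natTrailingDegree = (grd g).natDegree → Iso (grd g).natDegree g := by
    intro g hg
    have : grd g = Polynomial.C ((grd g).coeff (grd g).natDegree) * Polynomial.X ^ (grd g).natDegree := by
      ext1 n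
      rw [Polynomial.coeff_C_mul_X_pow]
      split_ifs with hn
      · rw [hn]
      · rcases lt_or_gt_of_ne hn with h | h
        · exact Polynomial.coeff_eq_zero_of_lt_natTrailingDegree (by omega)
        · exact Polynomial.coeff_eq_zero_of_natDegree_lt h
    have h5 : (grd g).coeff (grd g).natDegree = g := by
      have := congrArg (Polynomial.eval 1) this
      rw [eval_grd] at this
      simpa using this.symm
    rw [h5] at this
    exact this
  exact ⟨_, _, h1, key a (by omega), key b (by omega)⟩

lemma Iso.mon (c : K) (a b : ℕ) :
    Iso (4 * a + 6 * b) (MvPolynomial.C c * (SerreCor.vQ ^ a * SerreCor.vR ^ b) : SP K) :=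
  ((Iso.vQ.pow a).mul (Iso.vR.pow b)).smul c

lemma monomial_eq' (d : Fin 2 →₀ ℕ) (c : K) :
    (MvPolynomial.monomial d c : SP K) = MvPolynomial.C c * (SerreCor.vQ ^ (d 0) * SerreCor.vR ^ (d 1)) := by
  rw [MvPolynomial.monomial_eq, Finsupp.prod_fintype _ _ (fun i => pow_zero _), Fin.prod_univ_two]

lemma Iso.induct {k : ℕ} (P : SP K → Prop) (h0 : P 0) (hadd : ∀ g h, P g → P h → P (g + h))
    (hmon : ∀ c a b, 4 * a + 6 * b = k → P (MvPolynomial.C c * (SerreCor.vQ ^ a * SerreCor.vR ^ b)))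
    {g : SP K} (hg : Iso k g) : P g := by
  have h1 : ∀ g : SP K, P ((grd g).coeff k) := by
    intro g
    induction g using MvPolynomial.induction_on' with
    | monomial d c =>
      rw [monomial_eq', Iso.mon, Polynomial.coeff_C_mul_X_pow]
      split_ifs with h
      · exact hmon _ _ _ h.symm
      · exact h0
    | add f g ih1 ih2 =>
      rw [map_add, Polynomial.coeff_add]
      exact hadd _ _ ih1 ih2
  have := h1 g
  rw [hg, Polynomial.coeff_C_mul_X_pow, if_pos rfl] at this
  exact this

end alg

end SerreCor

end

section

namespace SerreCor

section alg2
variable {K : Type*} [Field K]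

lemma Iso.cast {k l : ℕ} {g : SP K} (h : Iso k g) (e : k = l) : Iso l g := e ▸ h

lemma Iso.neg {k : ℕ} {g : SP K} (hg : Iso k g) : Iso k (-g) := by
  simpa using (Iso.zero k).sub hg

noncomputable def dP : Derivation K (SP K) (SP K) :=
  MvPolynomial.mkDerivation K ![MvPolynomial.C (-4) * vR, MvPolynomial.C (-6) * vQ ^ 2]

lemma dP_Q : dP (vQ : SP K) = MvPolynomial.C (-4) * vR := by simp [dP, MvPolynomial.mkDerivation_X]
lemma dP_R : dP (vR : SP K) = MvPolynomial.C (-6) * vQ ^ 2 := by simp [dP, MvPolynomial.mkDerivation_X]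

lemma dP_mul (g h : SP K) : dP (g * h) = g * dP h + h * dP g := by
  rw [Derivation.leibniz]; rfl

noncomputable def ev : SP K →ₐ[K] PowerSeries K :=
  MvPolynomial.aeval ![fromZ K eQ, fromZ K eR]

lemma ev_Q : ev (vQ : SP K) = fromZ K eQ := by simp [ev]
lemma ev_R : ev (vR : SP K) = fromZ K eR := by simp [ev]
lemma ev_C (c : K) : ev (MvPolynomial.C c : SP K) = PowerSeries.C c := by
  rw [← MvPolynomial.algebraMap_eq, AlgHom.commutes]; rfl

def TT (k : ℕ) (g : SP K) : Prop :=
  Iso k g ∧ Iso (k + 2) (dP g) ∧ ev (dP g) = 12 * thetaC (ev g) - (k : PowerSeries K) * fromZ K eP * ev g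

lemma TT.C (c : K) : TT 0 (MvPolynomial.C c : SP K) := by
  have h : dP (MvPolynomial.C c : SP K) = 0 := by rw [← MvPolynomial.algebraMap_eq, Derivation.map_algebraMap]
  refine ⟨Iso.C c, ?_, ?_⟩
  · rw [h]; exact Iso.zero _
  · rw [h, ev_C, thetaC_C]; simp

lemma TT.mul {k l : ℕ} {g h : SP K} (hg : TT k g) (hh : TT l h) : TT (k + l) (g * h) := by
  obtain ⟨g1, g2, g3⟩ := hg
  obtain ⟨h1, h2, h3⟩ := hh
  refine ⟨g1.mul h1, ?_, ?_⟩
  · rw [dP_mul]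
    exact ((g1.mul h2).cast (by ring)).add ((h1.mul g2).cast (by ring))
  · rw [dP_mul, map_add, map_mul, map_mul, map_mul, g3, h3, thetaC_mul]; push_cast; ring

lemma TT.pow {k : ℕ} {g : SP K} (hg : TT k g) (n : ℕ) : TT (k * n) (g ^ n) := by
  induction n with
  | zero => simpa using TT.C (1 : K)
  | succ n ih => rw [pow_succ]; exact ih.mul hg

lemma TT.vQ : TT 4 (SerreCor.vQ : SP K) := by
  refine ⟨Iso.vQ, ?_, ?_⟩
  · rw [dP_Q]; exact Iso.vR.smul _
  · rw [dP_Q, map_mul, ev_C, ev_Q, ev_R]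
    have := ramK_Q (R := K)
    simp only [map_neg, map_ofNat]
    linear_combination -4 * this

lemma TT.vR : TT 6 (SerreCor.vR : SP K) := by
  refine ⟨Iso.vR, ?_, ?_⟩
  · rw [dP_R]; exact (Iso.vQ.pow 2).smul _
  · rw [dP_R, map_mul, map_pow, ev_C, ev_Q, ev_R]
    have := ramK_R (R := K)
    simp only [map_neg, map_ofNat]
    linear_combination -6 * this

lemma Iso.TT {k : ℕ} {g : SP K} (hg : Iso k g) : TT k g := by
  refine Iso.induct (SerreCor.TT k) ?_ ?_ ?_ hg
  · exact ⟨Iso.zero _, by rw [map_zero]; exact Iso.zero _, by simp [thetaC_eq]⟩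
  · rintro g h ⟨g1, g2, g3⟩ ⟨h1, h2, h3⟩
    refine ⟨g1.add h1, by rw [map_add]; exact g2.add h2, ?_⟩
    rw [map_add, map_add, map_add, g3, h3, thetaC_add]; ring
  · intro c a b h
    have := (TT.C c).mul ((TT.vQ.pow a).mul (TT.vR.pow b))
    rw [zero_add, h] at this
    exact this

lemma Iso.dP {k : ℕ} {g : SP K} (hg : Iso k g) : Iso (k + 2) (dP g) := hg.TT.2.1
lemma ev_dP {k : ℕ} {g : SP K} (hg : Iso k g) :
    ev (dP g) = 12 * thetaC (ev g) - (k : PowerSeries K) * fromZ K eP * ev g := hg.TT.2.2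

lemma Iso.two {g : SP K} (hg : Iso 2 g) : g = 0 := by
  refine Iso.induct (fun g => g = 0) rfl ?_ ?_ hg
  · rintro g h rfl rfl; simp
  · intro c a b h; omega

lemma Iso.wt_zero {g : SP K} (hg : Iso 0 g) : ∃ c, g = MvPolynomial.C c := by
  refine Iso.induct (fun g => ∃ c, g = MvPolynomial.C c) ⟨0, by simp⟩ ?_ ?_ hg
  · rintro g h ⟨c, rfl⟩ ⟨d, rfl⟩; exact ⟨c + d, by simp⟩
  · intro c a b h
    have : a = 0 := by omega
    have : b = 0 := by omega
    subst a b; exact ⟨c, by simp⟩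

lemma ev_delta : ev (vQ ^ 3 - vR ^ 2 : SP K) = 1728 * fromZ K eD := by
  rw [map_sub, map_pow, map_pow, ev_Q, ev_R]
  have := congrArg (fromZ K) eD_eq
  simpa only [map_mul, map_sub, map_ofNat, map_pow] using this.symm

lemma fromZ_eD_ne : fromZ K eD ≠ 0 := by
  intro h
  have := congrArg (PowerSeries.coeff 1) h
  simp [fromZ, eD_coeff_one] at this

lemma c0_ev_Q : PowerSeries.constantCoeff (ev (vQ : SP K)) = 1 := by
  rw [ev_Q]; exact coeff0_fromZ_eis ..
lemma c0_ev_R : PowerSeries.constantCoeff (ev (vR : SP K)) = 1 := by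
  rw [ev_R]; exact coeff0_fromZ_eis ..

lemma iso_delta : Iso 12 (vQ ^ 3 - vR ^ 2 : SP K) := (Iso.vQ.pow 3).sub (Iso.vR.pow 2)

/-- every isobaric polynomial is a multiple of a fixed monomial modulo delta -/
lemma Iso.mod_delta {k a0 b0 : ℕ} (hk : 4 * a0 + 6 * b0 = k) (hb : b0 < 2) {g : SP K} (hg : Iso k g) :
    ∃ c, (SerreCor.vQ ^ 3 - SerreCor.vR ^ 2) ∣
      g - MvPolynomial.C c * (SerreCor.vQ ^ a0 * SerreCor.vR ^ b0) := by
  refine Iso.induct (fun g => ∃ c, (SerreCor.vQ ^ 3 - SerreCor.vR ^ 2) ∣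
      g - MvPolynomial.C c * (SerreCor.vQ ^ a0 * SerreCor.vR ^ b0)) ⟨0, by simp⟩ ?_ ?_ hg
  · rintro g h ⟨c, hc⟩ ⟨d, hd⟩
    refine ⟨c + d, ?_⟩
    convert dvd_add hc hd using 1
    rw [map_add]; ring
  · intro c a b h
    refine ⟨c, ?_⟩
    obtain ⟨t, ht⟩ : ∃ t, b = b0 + 2 * t := ⟨(b - b0) / 2, by omega⟩
    have ha : a0 = a + 3 * t := by omega
    subst ht ha
    have := (sub_dvd_pow_sub_pow (SerreCor.vQ ^ 3 : SP K) (SerreCor.vR ^ 2) t).mul_right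
      (-(MvPolynomial.C c * (SerreCor.vQ ^ a * SerreCor.vR ^ b0)))
    convert this using 1
    rw [← pow_mul, ← pow_mul]; ring

variable (h2 : (2 : K) ≠ 0) (h3 : (3 : K) ≠ 0)
include h2 h3

lemma ev_inj_iso : ∀ (k : ℕ) {g : SP K}, Iso k g → ev g = 0 → g = 0 := by
  intro k
  induction k using Nat.strong_induction_on with
  | _ k ih =>
  intro g hg h0
  by_cases hex : ∃ a0 b0, b0 < 2 ∧ 4 * a0 + 6 * b0 = k
  · obtain ⟨a0, b0, hb, hk⟩ := hex
    obtain ⟨c, d, hd⟩ := hg.mod_delta hk hb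
    have hc : c = 0 := by
      have := congrArg (fun x => PowerSeries.constantCoeff (ev x)) hd
      simp only [map_sub, map_mul, map_pow, c0_ev_Q, c0_ev_R, h0, ev_C] at this
      simpa using this
    rw [hc, map_zero, zero_mul, sub_zero] at hd
    by_contra hne
    rw [hd] at hne hg h0
    obtain ⟨i, j, hij, hi, hj⟩ := hg.factor hne
    have hi12 := Iso.weight_unique (left_ne_zero_of_mul hne) hi iso_delta
    have h1728 : (1728 : PowerSeries K) ≠ 0 := by
      have : (1728 : PowerSeries K) = PowerSeries.C (2 ^ 6 * 3 ^ 3 : K) := by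
        norm_num
        exact (map_ofNat _ 1728).symm
      rw [this, Ne, map_eq_zero_iff _ PowerSeries.C_injective]
      exact mul_ne_zero (pow_ne_zero _ h2) (pow_ne_zero _ h3)
    rw [map_mul, ev_delta] at h0
    have := (mul_eq_zero.mp h0).resolve_left (mul_ne_zero h1728 fromZ_eD_ne)
    exact right_ne_zero_of_mul hne (ih j (by omega) hj this)
  · refine Iso.induct (fun g => g = 0) rfl ?_ ?_ hg
    · rintro g h rfl rfl; simp
    · intro c a b h
      exact (hex ⟨a + 3 * (b / 2), b % 2, by omega, by omega⟩).elim

end alg2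

end SerreCor

end

section

namespace SerreCor

section alg3
variable {K : Type*} [Field K] {p : ℕ} [hp : Fact p.Prime] [CharP K p] 

omit hp [CharP K p] in
lemma prime_pow_absurd {π a : SP K} (hπ : Prime π) (ha : ¬ π ∣ a) (s : ℕ) (h : π ^ (s + 1) ∣ π ^ s * a) : False := by
  rw [pow_succ] at h
  exact ha ((mul_dvd_mul_iff_left (pow_ne_zero s hπ.ne_zero)).mp h)

omit hp [CharP K p] in
lemma not_dvd_pow {π a : SP K} (hπ : Prime π) (ha : ¬ π ∣ a) (s : ℕ) : ¬ π ∣ a ^ s :=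
  fun h => ha (hπ.dvd_of_dvd_pow h)

omit hp [CharP K p] in
lemma not_dvd_mul {π a b : SP K} (hπ : Prime π) (ha : ¬ π ∣ a) (hb : ¬ π ∣ b) : ¬ π ∣ a * b :=
  fun h => (hπ.dvd_or_dvd h).elim ha hb

omit hp in
lemma cast_ne_zero_of_lt {n : ℕ} (h0 : 0 < n) (h : n < p) : (n : K) ≠ 0 := by
  rw [Ne, CharP.cast_eq_zero_iff K p]
  exact Nat.not_dvd_of_pos_of_lt h0 h

omit hp in
lemma not_dvd_natCast_mul {π a : SP K} (hπ : Prime π) {n : ℕ} (hn : (n : K) ≠ 0) (ha : ¬ π ∣ a) :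
    ¬ π ∣ (n : SP K) * a := by
  refine not_dvd_mul hπ (fun h => hπ.not_isUnit (isUnit_of_dvd_unit h ?_)) ha
  have : (n : SP K) = MvPolynomial.C (n : K) := (map_natCast _ _).symm
  rw [this]
  exact (isUnit_iff_ne_zero.mpr hn).map MvPolynomial.C

lemma cast_pred : ((p - 1 : ℕ) : K) = -1 := by
  rw [Nat.cast_sub hp.out.one_le, CharP.cast_eq_zero]; simp

variable (h5 : 5 ≤ p) 
include h5

lemma two_ne : (2 : K) ≠ 0 := by exact_mod_cast cast_ne_zero_of_lt (K := K) (p := p) (n := 2) (by omega) (by omega)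
lemma three_ne : (3 : K) ≠ 0 := by exact_mod_cast cast_ne_zero_of_lt (K := K) (p := p) (n := 3) (by omega) (by omega)

lemma iso_eq {k : ℕ} {g h : SP K} (hg : Iso k g) (hh : Iso k h) (he : ev g = ev h) : g = h := by
  have := ev_inj_iso (two_ne (K := K) h5) (three_ne h5) k (hg.sub hh) (by rw [map_sub, he, sub_self])
  exact sub_eq_zero.mp this

variable {A : SP K} (hA : Iso (p - 1) A) (hA1 : ev A = 1)
include hA hA1

omit h5 in
lemma ev_dA : ev (dP A) = fromZ K eP := by
  rw [ev_dP hA, hA1]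
  have h1 : thetaC (1 : PowerSeries K) = 0 := by simpa using thetaC_C (1 : K)
  have h2 : ((p - 1 : ℕ) : PowerSeries K) = -1 := by
    have := congrArg (PowerSeries.C (R := K)) (cast_pred (K := K) (p := p))
    simpa using this
  rw [h1, h2]; ring

lemma ddA : dP (dP A) = - (vQ * A) := by
  refine iso_eq h5 hA.dP.dP ((Iso.vQ.mul hA).neg.cast (by omega)) ?_
  rw [ev_dP hA.dP, ev_dA hA hA1, ramK_P, map_neg, map_mul, hA1, ev_Q]
  have h2 : ((p - 1 + 2 : ℕ) : PowerSeries K) = 1 := by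
    have := congrArg (PowerSeries.C (R := K)) (cast_pred (K := K) (p := p))
    push_cast
    simp at this
    rw [this]; norm_num
  rw [h2]; ring

lemma A_structure : ∃ π h : SP K, Prime π ∧ A = π * h ∧ ¬ π ∣ h ∧ ¬ π ∣ dP A := by
  have hA0 : A ≠ 0 := by rintro rfl; simp at hA1
  have hAu : ¬ IsUnit A := by
    intro hu
    obtain ⟨B, hB⟩ := hu.exists_right_inv
    have h1 : Iso 0 (A * B) := by rw [hB]; exact Iso.one
    obtain ⟨i, j, hij, hi, hj⟩ := h1.factor (by rw [hB]; exact one_ne_zero)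
    have := Iso.weight_unique hA0 hi hA
    omega
  obtain ⟨π, hπi, hπA⟩ := WfDvdMonoid.exists_irreducible_factor hAu hA0
  have hπ : Prime π := hπi.prime
  obtain ⟨a, h, hπh, hAe⟩ := WfDvdMonoid.max_power_factor hA0 hπi
  -- weights
  have hπ0 := hπ.ne_zero
  have hh0 : h ≠ 0 := by rintro rfl; simp at hπh
  obtain ⟨w, hw⟩ : ∃ w, Iso w π := by
    obtain ⟨t, ht⟩ := hπA
    rw [ht] at hA hA0
    obtain ⟨i, j, -, hi, -⟩ := hA.factor hA0
    exact ⟨i, hi⟩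
  have hwpos : 0 < w := by
    rcases Nat.eq_zero_or_pos w with h0 | h0
    · subst h0
      obtain ⟨c, hc⟩ := hw.wt_zero
      exfalso
      apply hπ.not_isUnit
      rw [hc] at hπ0 ⊢
      have : c ≠ 0 := by rintro rfl; simp at hπ0
      exact (isUnit_iff_ne_zero.mpr this).map MvPolynomial.C
    · exact h0
  have hwa : w * a ≤ p - 1 := by
    have h1 := hA
    rw [hAe] at h1
    obtain ⟨i, j, hij, hi, hj⟩ := h1.factor (by rw [← hAe]; exact hA0)
    have := Iso.weight_unique (pow_ne_zero a hπ0) hi (hw.pow a)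
    omega
  have ha1 : 1 ≤ a := by
    rcases Nat.eq_zero_or_pos a with h0 | h0
    · subst h0
      rw [pow_zero, one_mul] at hAe
      rw [hAe] at hπA
      exact absurd hπA hπh
    · exact h0
  have hwp : w < p := by nlinarith [hp.out.one_lt, Nat.sub_lt hp.out.pos one_pos]
  have hap : a < p := by nlinarith [hp.out.one_lt, Nat.sub_lt hp.out.pos one_pos]
  have hDπ : ¬ π ∣ dP π := by
    rintro ⟨g, hg⟩
    have hD0 : dP π = 0 := by
      by_contra hne
      have h1 := hw.dP
      rw [hg] at h1 hne
      obtain ⟨i, j, hij, hi, hj⟩ := h1.factor hne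
      have := Iso.weight_unique hπ0 hi hw
      have hj2 : Iso 2 g := hj.cast (by omega)
      exact right_ne_zero_of_mul hne hj2.two
    have h1 := ev_dP hw
    rw [hD0, map_zero] at h1
    have h2 := congrArg PowerSeries.constantCoeff h1
    simp only [map_zero, map_sub, map_mul, coeff0_thetaC, mul_zero, zero_sub, map_natCast] at h2
    have h3 : PowerSeries.constantCoeff (fromZ K eP) = 1 := coeff0_fromZ_eis ..
    rw [h3, mul_one] at h2
    have h4 := (mul_eq_zero.mp (neg_eq_zero.mp h2.symm)).resolve_left
      (cast_ne_zero_of_lt (K := K) (p := p) hwpos hwp)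
    obtain ⟨t, ht⟩ := hπA
    have h5 := congrArg (fun x => PowerSeries.constantCoeff (ev x)) ht
    simp only [hA1, map_mul, h4, zero_mul, map_one] at h5
    exact one_ne_zero h5
  have ha : a = 1 := by
    by_contra hne
    obtain ⟨b, rfl⟩ : ∃ b, a = b + 2 := ⟨a - 2, by omega⟩
    have hdd := ddA h5 hA hA1
    have e1 : dP A = π ^ (b + 1) * (((b + 2 : ℕ) : SP K) * (h * dP π) + π * dP h) := by
      rw [hAe, dP_mul, Derivation.leibniz_pow, nsmul_eq_mul, smul_eq_mul,
        show b + 2 - 1 = b + 1 by omega]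
      ring
    have e2 : ∃ r, dP (dP A) = π ^ b * (((b + 1 : ℕ) : SP K) * (((b + 2 : ℕ) : SP K) * (h * (dP π * dP π)))) + π ^ (b + 1) * r := by
      refine ⟨((b + 1 : ℕ) : SP K) * (dP h * dP π) + dP (((b + 2 : ℕ) : SP K) * (h * dP π) + π * dP h), ?_⟩
      rw [e1, dP_mul, Derivation.leibniz_pow, nsmul_eq_mul, smul_eq_mul, show b + 1 - 1 = b by omega]
      ring
    obtain ⟨r, hr⟩ := e2
    rw [hdd, hAe] at hr
    refine prime_pow_absurd (a := ((b + 1 : ℕ) : SP K) * (((b + 2 : ℕ) : SP K) * (h * (dP π * dP π)))) hπ ?_ b ?_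
    · refine not_dvd_natCast_mul hπ (cast_ne_zero_of_lt (p := p) (by omega) (by omega)) ?_
      refine not_dvd_natCast_mul hπ (cast_ne_zero_of_lt (p := p) (by omega) (by omega)) ?_
      exact not_dvd_mul hπ hπh (not_dvd_mul hπ hDπ hDπ)
    · refine ⟨-(vQ * (π * h)) - r, ?_⟩
      linear_combination -hr
  subst ha
  rw [pow_one] at hAe
  refine ⟨π, h, hπ, hAe, hπh, ?_⟩
  rw [hAe, dP_mul, dvd_add_right (dvd_mul_right _ _)]
  exact not_dvd_mul hπ hπh hDπ

lemma weight_of_ev_one {k : ℕ} {G : SP K} (hG : Iso k G) (hG1 : ev G = 1) : (p - 1) ∣ k := by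
  obtain ⟨π, h, hπ, hAe, hπh, -⟩ := A_structure h5 hA hA1
  have hG0 : G ≠ 0 := by rintro rfl; simp at hG1
  have he : G ^ (p - 1) = A ^ k := iso_eq h5 (hG.pow (p - 1)) ((hA.pow k).cast (by ring)) (by
    rw [map_pow, map_pow, hG1, hA1, one_pow, one_pow])
  obtain ⟨u, g, hg, hGe⟩ := WfDvdMonoid.max_power_factor hG0 hπ.irreducible
  rw [hGe, hAe, mul_pow, mul_pow, ← pow_mul] at he
  rcases lt_trichotomy (u * (p - 1)) k with hl | hl | hl
  · exact (prime_pow_absurd hπ (not_dvd_pow hπ hg (p - 1)) _ (he ▸ (pow_dvd_pow π hl).mul_right _)).elim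
  · exact ⟨u, by rw [← hl, mul_comm]⟩
  · exact (prime_pow_absurd hπ (not_dvd_pow hπ hπh k) _ (he ▸ (pow_dvd_pow π hl).mul_right _)).elim

lemma theta_chain {π h : SP K} (hπ : Prime π) (hAe : A = π * h) (hπd : ¬ π ∣ dP A) :
    ∀ j, j < p - 1 → ∃ g : SP K, Iso ((p + 1) * (j + 1)) g ∧
      ev g = 12 ^ j * thetaC^[j] (fromZ K eP) ∧ ¬ π ∣ g := by
  intro j
  induction j with
  | zero => 
    intro _
    exact ⟨dP A, hA.dP.cast (by omega), by rw [ev_dA hA hA1]; simp, hπd⟩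
  | succ j ih =>
    intro hj
    obtain ⟨g, g1, g2, g3⟩ := ih (by omega)
    have h12 : ∀ (n : ℕ) (x : PowerSeries K), thetaC (12 ^ n * x) = 12 ^ n * thetaC x := by
      intro n x
      have : (12 ^ n : PowerSeries K) = PowerSeries.C (12 ^ n : K) := by
        rw [map_pow, map_ofNat]
      rw [this, thetaC_mul, thetaC_C]; ring
    refine ⟨A * dP g + ((((p + 1) * (j + 1) : ℕ) : SP K)) * (g * dP A), ?_, ?_, ?_⟩
    · refine ((hA.mul g1.dP).cast ?_).add ?_
      · zify [hp.out.one_le]; push_cast; ring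
      · have := (g1.mul hA.dP).smul ((((p + 1) * (j + 1) : ℕ) : K))
        rw [map_natCast] at this
        refine this.cast ?_
        zify [hp.out.one_le]; push_cast; ring
    · rw [map_add, map_mul, map_mul, map_mul, map_natCast, hA1, ev_dA hA hA1, ev_dP g1,
        Function.iterate_succ_apply', g2, h12]
      ring
    · rw [hAe, dvd_add_right (by rw [mul_assoc]; exact dvd_mul_right _ _), ← hAe]
      refine not_dvd_natCast_mul hπ ?_ (not_dvd_mul hπ g3 hπd)
      push_cast
      rw [CharP.cast_eq_zero, zero_add, one_mul]
      exact_mod_cast cast_ne_zero_of_lt (K := K) (p := p) (n := j + 1) (by omega) (by omega)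

lemma no_phi {n : ℕ} {Φ : SP K} (hΦ : Iso (n * (p - 1)) Φ) (hΦ0 : Φ ≠ 0) {c : K} (hc : c ≠ 0)
    (hφ : ev Φ - ev Φ ^ p = PowerSeries.C c * thetaC^[p - 2] (fromZ K eP)) : False := by
  obtain ⟨π, h, hπ, hAe, hπh, hπd⟩ := A_structure h5 hA hA1
  obtain ⟨g, g1, g2, g3⟩ := theta_chain h5 hA hA1 hπ hAe hπd (p - 2) (by omega)
  have h12 : (12 : K) ≠ 0 := by
    have := mul_ne_zero (mul_ne_zero (two_ne (K := K) h5) (two_ne (K := K) h5)) (three_ne (K := K) h5)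
    norm_num at this
    exact this
  obtain ⟨g', hg', hge, hgd⟩ : ∃ g' : SP K, Iso ((p + 1) * (p - 1)) g' ∧
      ev g' = ev Φ - ev Φ ^ p ∧ ¬ π ∣ g' := by
    refine ⟨MvPolynomial.C (c / 12 ^ (p - 2)) * g, (g1.smul _).cast ?_, ?_, ?_⟩
    · congr 1; omega
    · rw [map_mul, ev_C, g2, hφ, ← mul_assoc]
      congr 1
      have : (12 ^ (p - 2) : PowerSeries K) = PowerSeries.C (12 ^ (p - 2) : K) := by
        rw [map_pow, map_ofNat]
      rw [this, ← map_mul, div_mul_cancel₀ _ (pow_ne_zero _ h12)]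
    · refine not_dvd_mul hπ (fun hd => hπ.not_isUnit (isUnit_of_dvd_unit hd ?_)) g3
      exact (isUnit_iff_ne_zero.mpr (div_ne_zero hc (pow_ne_zero _ h12))).map MvPolynomial.C
  have key : Φ ^ p * A ^ (n + p + 1) + g' * A ^ (p * n + n) = Φ * A ^ (p * n + p + 1) := by
    refine iso_eq h5 (k := (p * n + n + p + 1) * (p - 1)) ?_ ?_ ?_
    · refine Iso.add (((hΦ.pow p).mul (hA.pow _)).cast ?_) ((hg'.mul (hA.pow _)).cast ?_)
      · ring
      · ring
    · exact (hΦ.mul (hA.pow _)).cast (by ring)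
    · simp only [map_add, map_mul, map_pow, hA1, one_pow, mul_one, hge]; ring
  obtain ⟨u, f, hf, hfe⟩ := WfDvdMonoid.max_power_factor hΦ0 hπ.irreducible
  have e1 : Φ ^ p * A ^ (n + p + 1) = π ^ (p * u + (n + p + 1)) * (f ^ p * h ^ (n + p + 1)) := by
    rw [hfe, hAe]; ring
  have e2 : g' * A ^ (p * n + n) = π ^ (p * n + n) * (g' * h ^ (p * n + n)) := by
    rw [hAe]; ring
  have e3 : Φ * A ^ (p * n + p + 1) = π ^ (u + (p * n + p + 1)) * (f * h ^ (p * n + p + 1)) := by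
    rw [hfe, hAe]; ring
  rw [e1, e2, e3] at key
  have hd : ∀ {s t : ℕ} (y : SP K), s < t → π ^ (s + 1) ∣ π ^ t * y :=
    fun y h => (pow_dvd_pow π h).mul_right _
  by_cases hu : u + 2 ≤ n
  · refine prime_pow_absurd hπ (not_dvd_mul hπ (not_dvd_pow hπ hf p) (not_dvd_pow hπ hπh (n + p + 1)))
      (p * u + (n + p + 1)) ?_
    rw [eq_sub_of_add_eq key]
    refine dvd_sub (hd _ ?_) (hd _ ?_)
    · nlinarith
    · nlinarith
  · refine prime_pow_absurd hπ (not_dvd_mul hπ hgd (not_dvd_pow hπ hπh (p * n + n)))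
      (p * n + n) ?_
    rw [eq_sub_of_add_eq' key]
    refine dvd_sub (hd _ ?_) (hd _ ?_)
    · nlinarith
    · nlinarith

end alg3

end SerreCor

end

section

namespace SerreCor

variable {p : ℕ} [hp : Fact p.Prime]

lemma pow_p_eq (φ : PowerSeries (ZMod p)) : φ ^ p = PowerSeries.expand p hp.out.ne_zero φ := by
  have h := MvPowerSeries.map_frobenius_expand (σ := Unit) (R := ZMod p) p hp.out.ne_zero (f := φ)
  rw [ZMod.frobenius_zmod] at h
  rw [MvPowerSeries.map_id] at h
  exact h.symm

lemma coeff_thetaC_iter {R : Type*} [CommRing R] (j n : ℕ) (c : PowerSeries R) :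
    PowerSeries.coeff n (thetaC^[j] c) = (n : R) ^ j * PowerSeries.coeff n c := by
  induction j with
  | zero => simp
  | succ j ih => rw [Function.iterate_succ_apply']; simp only [thetaC, PowerSeries.coeff_mk, ih]; ring

lemma phi_identity (h3 : 3 ≤ p) : fromZ (ZMod p) (sig (p - 2)) - fromZ (ZMod p) (sig (p - 2)) ^ p =
    thetaC^[p - 2] (fromZ (ZMod p) (sig 1)) := by
  have hfer : ∀ x : ZMod p, x ≠ 0 → x ^ (p - 1) = 1 := fun x hx => ZMod.pow_card_sub_one_eq_one hx
  have hc : ∀ j n, PowerSeries.coeff n (fromZ (ZMod p) (sig j)) = ∑ d ∈ n.divisors, (d : ZMod p) ^ j := by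
    intro j n
    simp [sig, ArithmeticFunction.sigma_apply]
  ext n
  rw [pow_p_eq, map_sub, PowerSeries.coeff_expand, coeff_thetaC_iter]
  simp only [hc]
  split_ifs with hpn
  · obtain ⟨t, rfl⟩ := hpn
    rw [Nat.mul_div_cancel_left _ hp.out.pos]
    have : ((p * t : ℕ) : ZMod p) = 0 := by simp
    rw [this, zero_pow (by omega), zero_mul, sub_eq_zero]
    rcases Nat.eq_zero_or_pos t with h0 | h0
    · subst h0; simp
    symm
    refine Finset.sum_subset (Nat.divisors_subset_of_dvd (Nat.mul_pos hp.out.pos h0).ne' (dvd_mul_left t p)) ?_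
    intro d hd hd'
    have hpd : p ∣ d := by
      by_contra hpd
      apply hd'
      rw [Nat.mem_divisors] at hd ⊢
      exact ⟨((Nat.Prime.coprime_iff_not_dvd hp.out).2 hpd).symm.dvd_of_dvd_mul_left hd.1, h0.ne'⟩
    rw [(ZMod.natCast_eq_zero_iff d p).2 hpd, zero_pow (by omega)]
  · rw [sub_zero, Finset.mul_sum, ← Nat.sum_div_divisors]
    refine Finset.sum_congr rfl fun d hd => ?_
    obtain ⟨e, he⟩ := Nat.dvd_of_mem_divisors hd
    have hd0 : 0 < d := Nat.pos_of_mem_divisors hd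
    have hn0 : (n : ZMod p) ≠ 0 := by rwa [Ne, ZMod.natCast_eq_zero_iff]
    rw [he, Nat.mul_div_cancel_left _ hd0]
    rw [he] at hn0
    push_cast at hn0 ⊢
    have hd1 : (d : ZMod p) ^ (p - 2) * d = 1 := by
      rw [← pow_succ, show p - 2 + 1 = p - 1 by omega]; exact hfer _ (left_ne_zero_of_mul hn0)
    rw [mul_pow, pow_one]
    linear_combination (-(e : ZMod p) ^ (p - 2)) * hd1

lemma phi_ne_zero : fromZ (ZMod p) (sig (p - 2)) ≠ 0 := by
  intro h
  have := congrArg (PowerSeries.coeff 1) h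
  simp [sig] at this

lemma phi_identity' (h5 : 5 ≤ p) : ∃ c : ZMod p, c ≠ 0 ∧ 
    fromZ (ZMod p) (sig (p - 2)) - fromZ (ZMod p) (sig (p - 2)) ^ p =
    PowerSeries.C c * thetaC^[p - 2] (fromZ (ZMod p) eP) := by
  have h24 : (24 : ZMod p) ≠ 0 := by
    have := mul_ne_zero (mul_ne_zero (pow_ne_zero 3 (two_ne (K := ZMod p) h5)) (three_ne (K := ZMod p) h5)) one_ne_zero
    norm_num at this
    exact this
  refine ⟨-(24)⁻¹, neg_ne_zero.mpr (inv_ne_zero h24), ?_⟩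
  rw [phi_identity (by omega)]
  ext n
  rw [PowerSeries.coeff_C_mul, coeff_thetaC_iter, coeff_thetaC_iter]
  rcases Nat.eq_zero_or_pos n with h0 | h0
  · subst h0; simp [show p - 2 ≠ 0 by omega]
  · have : PowerSeries.coeff n (fromZ (ZMod p) eP) = -24 * PowerSeries.coeff n (fromZ (ZMod p) (sig 1)) := by
      rw [eP, eis_eq, PowerSeries.coeff_map, PowerSeries.coeff_map, map_add, PowerSeries.coeff_C_mul,
        PowerSeries.coeff_one, if_neg h0.ne']
      simp
    rw [this]
    field_simp

end SerreCor

end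

section

open UpperHalfPlane hiding I
open scoped MatrixGroups ModularForm

namespace SerreCor

section gen
variable {S : Type*} [CommRing S]

lemma one_add_pow_prime {p : ℕ} (hp : p.Prime) (h3 : 3 ≤ p) (z : S) :
    ∃ r, (1 + z) ^ p = 1 + p * z + p * z ^ 2 * r + z ^ p := by
  obtain ⟨j, rfl⟩ : ∃ j, p = j + 2 := ⟨p - 2, by omega⟩
  have h1 : (1 + z) ^ (j + 2) = ∑ k ∈ Finset.range (j + 2 + 1), z ^ k * ((j + 2).choose k : S) := by
    rw [add_comm, add_pow]; simp
  have h2 : ((j + 2 : ℕ) : S) * z ^ 2 ∣ ∑ k ∈ Finset.range j, z ^ (k + 1 + 1) * ((j + 2).choose (k + 1 + 1) : S) := by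
    apply Finset.dvd_sum
    intro k hk
    rw [Finset.mem_range] at hk
    obtain ⟨t, ht⟩ := hp.dvd_choose_self (k := k + 1 + 1) (by omega) (by omega)
    rw [ht]
    exact ⟨z ^ k * t, by push_cast; ring⟩
  obtain ⟨r, hr⟩ := h2
  refine ⟨r, ?_⟩
  rw [h1, Finset.sum_range_succ, Finset.sum_range_succ', Finset.sum_range_succ', hr]
  simp
  ring

lemma binom_p {p : ℕ} (hp : p.Prime) (h3 : 3 ≤ p) (α : S) (s : ℕ) :
    ∃ β, (1 + p * α) ^ (p ^ s) = 1 + p ^ (s + 1) * (α + p * β) := by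
  induction s with
  | zero => exact ⟨0, by simp⟩
  | succ s ih =>
    obtain ⟨β, hβ⟩ := ih
    obtain ⟨r, hr⟩ := one_add_pow_prime hp h3 ((p : S) ^ (s + 1) * (α + p * β))
    rw [pow_succ p s, pow_mul, hβ, hr]
    obtain ⟨t, ht⟩ : ∃ t, (s + 1) * p = s + 3 + t := ⟨(s + 1) * p - (s + 3), by
      have : s + 3 ≤ (s + 1) * p := by nlinarith
      omega⟩
    refine ⟨β + (p : S) ^ s * (α + p * β) ^ 2 * r + (p : S) ^ t * (α + p * β) ^ p, ?_⟩
    rw [mul_pow _ _ p, ← pow_mul, ht]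
    ring

lemma binom_n {p : ℕ} (x : S) (t n : ℕ) :
    ∃ y, (1 + (p : S) ^ (t + 1) * x) ^ n = 1 + p ^ (t + 1) * (n * x + p * y) := by
  induction n with
  | zero => exact ⟨0, by simp⟩
  | succ n ih =>
    obtain ⟨y, hy⟩ := ih
    refine ⟨y + (p : S) ^ t * x * (n * x + p * y), ?_⟩
    rw [pow_succ, hy]
    push_cast
    ring

lemma binom {p : ℕ} (hp : p.Prime) (h3 : 3 ≤ p) (α : S) (s n : ℕ) :
    ∃ β, (1 + p * α) ^ (p ^ s * n) = 1 + p ^ (s + 1) * (n * α + p * β) := by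
  obtain ⟨β, hβ⟩ := binom_p hp h3 α s
  obtain ⟨y, hy⟩ := binom_n (p := p) (α + p * β) s n
  refine ⟨n * β + y, ?_⟩
  rw [pow_mul, hβ, hy]; ring

end gen

section red
variable {R : Type*} [CommRing R] {ι : R →+* ℂ} 

lemma IsMF.cancel {k : ℕ} {ψ : PowerSeries R} (c : R) (hc : ι c ≠ 0)
    (h : IsMF ι k (PowerSeries.C c * ψ)) : IsMF ι k ψ := by
  obtain ⟨f, hf⟩ := h
  refine ⟨(ι c)⁻¹ • f, ?_⟩
  have := ModularForm.qExpansion_smul one_pos one_mem_strictPeriods_SL (ι c)⁻¹ f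
  refine this.trans ?_
  rw [hf, map_mul, PowerSeries.map_C, PowerSeries.smul_eq_C_mul, ← mul_assoc, ← map_mul, inv_mul_cancel₀ hc]
  simp

variable {p : ℕ} [hp : Fact p.Prime] (red : R →+* ZMod p)

lemma reduce_pow (h3 : 3 ≤ p) {k w s n m : ℕ} (hk : k = w * (p ^ s * n)) (hs : s < m) {H α : PowerSeries R}
    (hH : IsMF ι k (1 + (p : PowerSeries R) ^ (m + 1) * H)) (hα : IsMF ι w (1 + p * α)) :
    ∃ ψ, IsMF ι k ψ ∧ PowerSeries.map red ψ = (n : PowerSeries (ZMod p)) * PowerSeries.map red α := by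
  obtain ⟨β, hβ⟩ := binom hp.out h3 α s n
  have h1 := hα.pow (p ^ s * n)
  rw [← hk, hβ] at h1
  obtain ⟨t, rfl⟩ : ∃ t, m = s + 1 + t := ⟨m - s - 1, by omega⟩
  refine ⟨n * α + p * β - p ^ (t + 1) * H, ?_, ?_⟩
  · apply IsMF.cancel ((p : R) ^ (s + 1))
    · rw [map_pow, map_natCast]
      exact pow_ne_zero _ (by exact_mod_cast hp.out.ne_zero)
    · convert h1.sub hH using 1
      rw [map_pow, map_natCast]
      ring
  · have : (p : PowerSeries (ZMod p)) = 0 := by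
      have := map_natCast (PowerSeries.C (R := ZMod p)) p
      rw [← this]; simp
    simp only [map_sub, map_add, map_mul, map_pow, map_natCast, this]
    ring

lemma IsMF.toSP {K : Type*} [Field K] (red : R →+* K) (h2 : (2 : K) ≠ 0) (h3 : (3 : K) ≠ 0) (hι : Function.Injective ι) :
    ∀ k ψ, IsMF ι k ψ → ∃ G : SP K, Iso k G ∧ ev G = PowerSeries.map red ψ := by
  have hz : ∀ φ : PowerSeries ℤ, PowerSeries.map red (fromZ R φ) = fromZ K φ := by
    intro φ; ext n; simp
  apply induct_MF hι
  · intro k; exact ⟨0, Iso.zero k, by simp⟩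
  · rintro k φ ψ ⟨G, g1, g2⟩ ⟨H, h1, h2⟩
    exact ⟨G + H, g1.add h1, by simp [g2, h2]⟩
  · intro c a b
    exact ⟨_, Iso.mon (red c) a b, by
      simp only [map_mul, map_pow, ev_C, ev_Q, ev_R, hz, PowerSeries.map_C]⟩
  · rintro k φ ⟨G, g1, g2⟩
    refine ⟨MvPolynomial.C (1728 : K)⁻¹ * ((vQ ^ 3 - vR ^ 2) * G), ((iso_delta.mul g1).smul _).cast (by ring), ?_⟩
    have h1728 : (1728 : K) ≠ 0 := by
      have := mul_ne_zero (pow_ne_zero 6 h2) (pow_ne_zero 3 h3)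
      norm_num at this
      exact this
    rw [map_mul, map_mul, ev_C, ev_delta, g2, map_mul, hz, ← map_ofNat (PowerSeries.C (R := K)), ← mul_assoc, ← mul_assoc, ← map_mul, inv_mul_cancel₀ h1728]
    simp

end red

end SerreCor

end

section

open UpperHalfPlane hiding I
open scoped MatrixGroups ModularForm

namespace SerreCor

section Rp
variable (p : ℕ) [hp : Fact p.Prime]

/-- p-integral rationals -/
noncomputable def Rp : Subring ℚ := (PadicInt.subring p).comap (Rat.castHom ℚ_[p])

variable {p}
lemma mem_Rp {x : ℚ} : x ∈ Rp p ↔ ‖(x : ℚ_[p])‖ ≤ 1 := Iff.rfl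

/-- embedding -/
noncomputable def iot : Rp p →+* ℂ := (Rat.castHom ℂ).comp (Rp p).subtype

lemma iot_inj : Function.Injective (iot (p := p)) :=
  (Rat.castHom ℂ).injective.comp Subtype.val_injective

noncomputable def toZp : Rp p →+* ℤ_[p] :=
  ((Rat.castHom ℚ_[p]).comp (Rp p).subtype).codRestrict (PadicInt.subring p) (fun x => x.2)

noncomputable def redp : Rp p →+* ZMod p := PadicInt.toZMod.comp toZp

lemma redp_eq_zero_iff (x : Rp p) : redp x = 0 ↔ ‖((x : ℚ) : ℚ_[p])‖ < 1 := by
  have h1 : redp x = 0 ↔ toZp x ∈ RingHom.ker (PadicInt.toZMod (p := p)) := by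
    rw [RingHom.mem_ker]; rfl
  rw [h1, PadicInt.ker_toZMod, IsLocalRing.mem_maximalIdeal, PadicInt.mem_nonunits]
  rfl

lemma exists_inv (x : Rp p) (hx : redp x ≠ 0) : ∃ y : Rp p, x * y = 1 := by
  have h1 : ‖((x : ℚ) : ℚ_[p])‖ = 1 := le_antisymm (mem_Rp.1 x.2) (not_lt.1 fun h => hx ((redp_eq_zero_iff x).2 h))
  have h0 : (x : ℚ) ≠ 0 := by
    intro h
    rw [h] at h1; simp at h1
  refine ⟨⟨(x : ℚ)⁻¹, mem_Rp.2 ?_⟩, ?_⟩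
  · push_cast
    rw [norm_inv, h1, inv_one]
  · apply Subtype.ext
    exact mul_inv_cancel₀ h0

lemma exists_pow_mul {x : ℚ} {s : ℕ} (h : ‖(x : ℚ_[p])‖ ≤ (p : ℝ) ^ (-(s : ℤ))) : ∃ y : Rp p, x = p ^ s * (y : ℚ) := by
  have hp0 : (p : ℚ) ≠ 0 := by exact_mod_cast hp.out.ne_zero
  refine ⟨⟨x / p ^ s, mem_Rp.2 ?_⟩, ?_⟩
  · push_cast
    rw [norm_div, norm_pow, Padic.norm_p]
    have : (0 : ℝ) < p := by exact_mod_cast hp.out.pos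
    rw [div_le_one (by positivity)]
    simpa using h
  · rw [mul_div_cancel₀ _ (pow_ne_zero _ hp0)]

lemma inv_prime_mem {q : ℕ} (hq : q.Prime) (hqp : q ≠ p) : (1 : ℚ) / q ∈ Rp p := by
  rw [mem_Rp]
  apply Padic.norm_rat_le_one
  rw [one_div, Rat.inv_natCast_den_of_pos hq.pos]
  intro h
  exact hqp ((Nat.prime_dvd_prime_iff_eq hp.out hq).1 h).symm

lemma bern (h3 : 3 ≤ p) : ∃ u : Rp p, (u : ℚ) = p * bernoulli (p - 1) ∧ redp u = -1 := by
  have hp0 : (p : ℚ) ≠ 0 := by exact_mod_cast hp.out.ne_zero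
  obtain ⟨k, hk⟩ : ∃ k, p - 1 = 2 * k := by
    obtain ⟨t, ht⟩ := hp.out.odd_of_ne_two (by omega)
    exact ⟨t, by omega⟩
  obtain ⟨n, hn⟩ := Bernoulli.vonStaudt_clausen k
  rw [← hk] at hn
  set s := {q ∈ Finset.range (p - 1 + 2) | q.Prime ∧ q - 1 ∣ p - 1} with hs
  have hps : p ∈ s := by
    rw [hs, Finset.mem_filter, Finset.mem_range]
    exact ⟨by omega, hp.out, dvd_rfl⟩
  rw [← Finset.add_sum_erase s _ hps] at hn
  have hx : bernoulli (p - 1) + 1 / p ∈ Rp p := by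
    have : bernoulli (p - 1) + 1 / p = (n : ℚ) - ∑ q ∈ s.erase p, (1 : ℚ) / q := by
      rw [hn]; ring
    rw [this]
    refine (Rp p).sub_mem (intCast_mem _ n) ((Rp p).sum_mem fun q hq => ?_)
    rw [Finset.mem_erase, hs, Finset.mem_filter] at hq
    exact inv_prime_mem hq.2.2.1 hq.1
  refine ⟨(p : Rp p) * ⟨_, hx⟩ - 1, ?_, ?_⟩
  · push_cast
    field_simp
    ring
  · rw [map_sub, map_mul, map_natCast, map_one]; simp

lemma eis_p (h5 : 5 ≤ p) : ∃ α : PowerSeries (Rp p), IsMF iot (p - 1) (1 + (p : PowerSeries (Rp p)) * α) ∧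
    ∃ c : ZMod p, c ≠ 0 ∧ PowerSeries.map redp α = PowerSeries.C c * fromZ (ZMod p) (sig (p - 2)) := by
  have hp0 : (p : ℚ) ≠ 0 := by exact_mod_cast hp.out.ne_zero
  obtain ⟨u, hu, hu1⟩ := bern (p := p) (by omega)
  obtain ⟨y, hy⟩ := exists_inv u (by rw [hu1]; exact neg_ne_zero.mpr one_ne_zero)
  have hy1 : redp y = -1 := by
    have := congrArg redp hy
    rw [map_mul, hu1, map_one] at this
    linear_combination -this
  refine ⟨PowerSeries.C (-(2 * ((p - 1 : ℕ) : Rp p) * y)) * fromZ (Rp p) (sig (p - 2)), ?_, 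
    redp (-(2 * ((p - 1 : ℕ) : Rp p) * y)), ?_, ?_⟩
  · have hk : 3 ≤ p - 1 := by omega
    refine ⟨ModularForm.E hk, ?_⟩
    ext n
    rw [EisensteinSeries.E_qExpansion_coeff hk (hp.out.even_sub_one (by omega))]
    rw [map_add, map_one, map_add, PowerSeries.coeff_one, RingHom.map_mul, RingHom.map_mul, map_natCast,
      ← map_natCast (PowerSeries.C (R := ℂ)), PowerSeries.coeff_C_mul, PowerSeries.map_C, PowerSeries.coeff_C_mul, map_fromZ]
    split_ifs with hn
    · subst hn; simp [sig]
    · have hB : (bernoulli (p - 1)) = (p : ℚ)⁻¹ * (u : ℚ) := by rw [hu]; field_simp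
      have huy : (u : ℚ) * (y : ℚ) = 1 := by
        have := congrArg Subtype.val hy
        exact this
      have hy0 : (y : ℚ) = (u : ℚ)⁻¹ := eq_inv_of_mul_eq_one_right huy
      have hc : iot (-(2 * ((p - 1 : ℕ) : Rp p) * y)) = (-(2 * ((p - 1 : ℕ) : ℂ) * ((u : ℚ) : ℂ)⁻¹)) := by
        rw [map_neg, map_mul, map_mul, map_natCast, map_ofNat]
        have : iot y = ((u : ℚ) : ℂ)⁻¹ := by
          rw [show iot y = ((y : ℚ) : ℂ) from rfl, hy0]; push_cast; rfl
        rw [this]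
      rw [hc, hB, show p - 1 - 1 = p - 2 by omega]
      have hpc : (p : ℂ) ≠ 0 := by exact_mod_cast hp.out.ne_zero
      have hu0 : ((u : ℚ) : ℂ) ≠ 0 := by
        have := left_ne_zero_of_mul_eq_one huy
        exact_mod_cast this
      simp [sig]
      field_simp
  · rw [map_neg, map_mul, map_mul, map_natCast, map_ofNat, hy1, cast_pred]
    have := two_ne (K := ZMod p) h5
    simpa using this
  · rw [map_mul, PowerSeries.map_C]
    congr 1
    ext n; simp

end Rp

theorem main_ge5 {p : ℕ} [hp : Fact p.Prime] (h5 : 5 ≤ p) (m k : ℕ) (H : PowerSeries (Rp p))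
    (hH : IsMF iot k (1 + (p : PowerSeries (Rp p)) ^ (m + 1) * H)) : (p - 1) * p ^ m ∣ k := by
  have h2 := two_ne (K := ZMod p) h5
  have h3 := three_ne (K := ZMod p) h5
  have hp0 : (p : PowerSeries (ZMod p)) = 0 := by
    rw [← map_natCast (PowerSeries.C (R := ZMod p)) p]; simp
  obtain ⟨α, hα, c, hc, hcα⟩ := eis_p (p := p) h5
  obtain ⟨A, hA, hA1⟩ := hα.toSP redp h2 h3 iot_inj
  rw [map_add, map_one, map_mul, map_natCast, hp0, zero_mul, add_zero] at hA1
  obtain ⟨G, hG, hG1⟩ := hH.toSP redp h2 h3 iot_inj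
  rw [map_add, map_one, map_mul, map_pow, map_natCast, hp0, zero_pow (by omega), zero_mul, add_zero] at hG1
  obtain ⟨n, hn⟩ := weight_of_ev_one h5 hA hA1 hG hG1
  rcases Nat.eq_zero_or_pos n with h0 | hnpos
  · subst h0; rw [hn, mul_zero]; exact dvd_zero _
  obtain ⟨s, n', hn', hne⟩ := Nat.exists_eq_pow_mul_and_not_dvd hnpos.ne' p hp.out.ne_one
  by_cases hsm : m ≤ s
  · rw [hn, hne]
    exact mul_dvd_mul_left _ ((pow_dvd_pow p hsm).mul_right _)
  exfalso
  obtain ⟨ψ, hψ, hψr⟩ := reduce_pow redp (by omega) (hn.trans (by rw [hne])) (not_le.1 hsm) hH hα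
  obtain ⟨Φ, hΦ, hΦe⟩ := hψ.toSP redp h2 h3 iot_inj
  rw [hψr, hcα, ← map_natCast (PowerSeries.C (R := ZMod p)), ← mul_assoc, ← map_mul] at hΦe
  have hd : (n' : ZMod p) * c ≠ 0 := mul_ne_zero (by rwa [Ne, ZMod.natCast_eq_zero_iff]) hc
  set d := (n' : ZMod p) * c with hd'
  have hev : ev (MvPolynomial.C d⁻¹ * Φ) = fromZ (ZMod p) (sig (p - 2)) := by
    rw [map_mul, ev_C, hΦe, ← mul_assoc, ← map_mul, inv_mul_cancel₀ hd]; simp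
  obtain ⟨c', hc', hφ⟩ := phi_identity' (p := p) h5
  refine no_phi h5 hA hA1 (n := n) (Φ := MvPolynomial.C d⁻¹ * Φ) ((hΦ.smul _).cast (by rw [hn, mul_comm])) ?_ hc' (by rw [hev, hφ])
  intro h
  rw [h, map_zero] at hev
  exact phi_ne_zero hev.symm

end SerreCor

end

section

open UpperHalfPlane hiding I
open scoped MatrixGroups ModularForm

namespace SerreCor

lemma theta_eD : thetaC eD = eP * eD := by
  have h := congrArg thetaC eD_eq
  have h0 : thetaC (1728 * eD) = 1728 * thetaC eD := by
    rw [← map_ofNat (PowerSeries.C (R := ℤ)), thetaC_mul, thetaC_C]; ring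
  have h1 : thetaC (eQ ^ 3 - eR ^ 2) = 3 * eQ ^ 2 * thetaC eQ - 2 * eR * thetaC eR := by
    have : thetaC (eQ ^ 3 - eR ^ 2) + thetaC (eR ^ 2) = thetaC (eQ ^ 3) := by
      rw [← thetaC_add]; congr 1; ring
    rw [eq_sub_of_add_eq this, show eQ ^ 3 = eQ * (eQ * eQ) by ring, show eR ^ 2 = eR * eR by ring]
    simp only [thetaC_mul]
    ring
  rw [h0, h1] at h
  have h1728 : (1728 : PowerSeries ℤ) ≠ 0 := by
    rw [← map_ofNat (PowerSeries.C (R := ℤ)), Ne, map_eq_zero_iff _ PowerSeries.C_injective]; norm_num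
  apply mul_left_cancel₀ h1728
  rw [h]
  linear_combination eQ ^ 2 * ram_Q - eR * ram_R - eP * eD_eq

section poly
variable {K : Type*} [Field K]

lemma aeval_ps_inj {x : PowerSeries K} (hx : x ≠ 0) (h0 : PowerSeries.constantCoeff x = 0) {h : Polynomial K}
    (hh : Polynomial.aeval x h = 0) : h = 0 := by
  by_contra hne
  obtain ⟨n, a, ha, rfl⟩ := WfDvdMonoid.max_power_factor hne Polynomial.irreducible_X
  rw [map_mul, map_pow, Polynomial.aeval_X] at hh
  have h1 := (mul_eq_zero.mp hh).resolve_left (pow_ne_zero n hx)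
  apply ha
  rw [Polynomial.X_dvd_iff]
  have h2 := congrArg PowerSeries.constantCoeff h1
  rw [Polynomial.aeval_def, Polynomial.hom_eval₂, h0, Polynomial.eval₂_at_zero, map_zero] at h2
  simpa using h2

lemma theta_aeval {x : PowerSeries K} (hx : thetaC x = x) (h : Polynomial K) :
    thetaC (Polynomial.aeval x h) = Polynomial.aeval x (Polynomial.X * Polynomial.derivative h) := by
  have hpow : ∀ n : ℕ, thetaC (x ^ n) = n * x ^ n := by
    intro n
    induction n with
    | zero => simpa using thetaC_C (1 : K)
    | succ n ih => rw [pow_succ, thetaC_mul, ih, hx]; push_cast; ring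
  induction h using Polynomial.induction_on' with
  | add f g hf hg => simp only [map_add, mul_add, thetaC_add, hf, hg]
  | monomial n c =>
    rw [← Polynomial.C_mul_X_pow_eq_monomial]
    have hC : Polynomial.aeval x (Polynomial.C c) = PowerSeries.C c := by
      rw [Polynomial.aeval_C]; rfl
    rw [Polynomial.derivative_C_mul_X_pow]
    cases n with
    | zero => simp [hC, thetaC_C]
    | succ n =>
      simp only [map_mul, map_pow, Polynomial.aeval_X, hC, thetaC_mul, thetaC_C, hpow, map_natCast,
        Nat.add_sub_cancel]
      push_cast
      ring

end poly

lemma z240 : ((240 : ℤ) : ZMod 3) = 0 := by decide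
lemma z504 : ((-504 : ℤ) : ZMod 3) = 0 := by decide
lemma z24 : ((-24 : ℤ) : ZMod 3) = 0 := by decide
lemma z80 : (80 : ZMod 3) ≠ 0 := by decide
lemma z3 : ∀ x : ZMod 3, x ^ 3 = x := by decide

section three
variable [hp : Fact (Nat.Prime 3)]

lemma fromZ_eis3 (a : ℤ) (ha : (a : ZMod 3) = 0) (j : ℕ) : fromZ (ZMod 3) (eis a j) = 1 := by
  rw [eis_eq, map_add, map_one, map_mul, PowerSeries.map_C]
  simp only [eq_intCast, ha]; simp

lemma IsMF.toPoly : ∀ k ψ, IsMF (iot (p := 3)) k ψ →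
    ∃ h : Polynomial (ZMod 3), PowerSeries.map redp ψ = Polynomial.aeval (fromZ (ZMod 3) eD) h := by
  have hz : ∀ φ : PowerSeries ℤ, PowerSeries.map (redp (p := 3)) (fromZ _ φ) = fromZ (ZMod 3) φ := by
    intro φ; ext n; simp
  apply induct_MF iot_inj
  · intro k; exact ⟨0, by simp⟩
  · rintro k φ ψ ⟨G, g2⟩ ⟨H, h2⟩
    exact ⟨G + H, by simp [g2, h2]⟩
  · intro c a b
    refine ⟨Polynomial.C (redp c), ?_⟩
    rw [map_mul, map_mul, map_pow, map_pow, hz, hz, SerreCor.eQ, SerreCor.eR, fromZ_eis3 _ z240, fromZ_eis3 _ z504,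
      PowerSeries.map_C, Polynomial.aeval_C]
    simp
  · rintro k φ ⟨G, g2⟩
    exact ⟨Polynomial.X * G, by rw [map_mul, map_mul, hz, g2, Polynomial.aeval_X]⟩

lemma no_poly (h : Polynomial (ZMod 3)) :
    fromZ (ZMod 3) (sig 1) ≠ Polynomial.aeval (fromZ (ZMod 3) eD) h := by
  intro he
  have hid := phi_identity (p := 3) le_rfl
  norm_num at hid
  have hD : thetaC (fromZ (ZMod 3) eD) = fromZ (ZMod 3) eD := by
    rw [← thetaC_fromZ, theta_eD, map_mul, eP, fromZ_eis3 _ z24, one_mul]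
  rw [he, theta_aeval hD, ← map_pow, ← map_sub, ← sub_eq_zero, ← map_sub] at hid
  have hc0 : PowerSeries.constantCoeff (fromZ (ZMod 3) eD) = 0 := by
    rw [← PowerSeries.coeff_zero_eq_constantCoeff_apply, PowerSeries.coeff_map,
      PowerSeries.coeff_zero_eq_constantCoeff_apply, eD_coeff_zero]; simp
  have h1 := aeval_ps_inj fromZ_eD_ne hc0 hid
  have h2 : h ^ 3 = h - Polynomial.X * Polynomial.derivative h := by linear_combination -h1
  have h3 := congrArg Polynomial.natDegree h2
  have h4 : (h - Polynomial.X * Polynomial.derivative h).natDegree ≤ h.natDegree := by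
    refine (Polynomial.natDegree_sub_le _ _).trans (max_le le_rfl ?_)
    by_cases hd : h.natDegree = 0
    · rw [Polynomial.derivative_of_natDegree_zero hd]; simp
    · refine Polynomial.natDegree_mul_le.trans ?_
      have := Polynomial.natDegree_derivative_lt hd
      have := Polynomial.natDegree_X_le (R := ZMod 3)
      omega
  rw [Polynomial.natDegree_pow] at h3
  have h5 : h.natDegree = 0 := by omega
  rw [Polynomial.eq_C_of_natDegree_eq_zero h5, Polynomial.aeval_C] at he
  have h6 := congrArg (PowerSeries.coeff 1) he
  rw [show (algebraMap (ZMod 3) (PowerSeries (ZMod 3))) = PowerSeries.C from rfl, PowerSeries.coeff_C] at h6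
  simp [sig] at h6

lemma sig3 : fromZ (ZMod 3) (sig 3) = fromZ (ZMod 3) (sig 1) := by
  ext n
  simp only [PowerSeries.coeff_map, sig, PowerSeries.coeff_mk, ArithmeticFunction.sigma_apply]
  simp only [eq_intCast]
  push_cast
  refine Finset.sum_congr rfl fun d _ => ?_
  rw [pow_one]
  generalize (d : ZMod 3) = x
  exact z3 x

theorem main_3 (m k : ℕ) (H : PowerSeries (Rp 3))
    (hH : IsMF (iot (p := 3)) k (1 + ((3 : ℕ) : PowerSeries (Rp 3)) ^ (m + 1) * H)) : (3 - 1) * 3 ^ m ∣ k := by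
  obtain ⟨k', hk⟩ : ∃ k', k = 2 * k' := by
    rcases Nat.even_or_odd' k with ⟨t, ht | ht⟩
    · exact ⟨t, ht⟩
    · exfalso
      obtain ⟨f, hf⟩ := hH
      have hf0 : f = 0 := ModularForm.levelOne_odd_weight_eq_zero ⟨t, by exact_mod_cast ht⟩ f
      rw [(ModularForm.qExpansion_eq_zero_iff one_pos one_mem_strictPeriods_SL f).2 hf0] at hf
      have h1 := congrArg PowerSeries.constantCoeff (PowerSeries.map_injective _ iot_inj (hf.symm.trans (map_zero _).symm))
      rw [map_add, map_mul, map_pow, map_natCast] at h1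
      have h2 := congrArg redp h1
      simp only [map_add, map_mul, map_pow, map_natCast, map_one, map_zero] at h2
      rw [show ((3 : ℕ) : ZMod 3) = 0 from ZMod.natCast_self 3] at h2
      simp at h2
  rcases Nat.eq_zero_or_pos k' with h0 | hnpos
  · subst h0; rw [hk, mul_zero]; exact dvd_zero _
  obtain ⟨s, n', hn', hne⟩ := Nat.exists_eq_pow_mul_and_not_dvd hnpos.ne' 3 (by norm_num)
  by_cases hsm : m ≤ s
  · rw [hk, hne]
    exact mul_dvd_mul_left _ ((pow_dvd_pow 3 hsm).mul_right _)
  exfalso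
  have hsq : IsMF (iot (p := 3)) (k * 2) (1 + ((3 : ℕ) : PowerSeries (Rp 3)) ^ (m + 1) * (2 * H + ((3 : ℕ) : PowerSeries (Rp 3)) ^ (m + 1) * H ^ 2)) := by
    convert hH.pow 2 using 1
    ring
  have hα : IsMF (iot (p := 3)) 4 (1 + ((3 : ℕ) : PowerSeries (Rp 3)) * fromZ _ (PowerSeries.C 80 * sig 3)) := by
    convert IsMF.eQ using 1
    rw [eQ, eis_eq, map_add, map_one]
    congr 1
    have : (240 : ℤ) = ((3 : ℕ) : ℤ) * 80 := by norm_num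
    rw [this, map_mul (PowerSeries.C (R := ℤ)), map_natCast (PowerSeries.C (R := ℤ)), mul_assoc, map_mul (fromZ _) ((3 : ℕ) : PowerSeries ℤ), map_natCast (fromZ _)]
  obtain ⟨ψ, hψ, hψr⟩ := reduce_pow redp le_rfl (w := 4) (s := s) (n := n') (by rw [hk, hne]; ring) (not_le.1 hsm) hsq hα
  obtain ⟨h, hh⟩ := hψ.toPoly
  have hz : PowerSeries.map (redp (p := 3)) (fromZ _ (PowerSeries.C 80 * sig 3)) = PowerSeries.C (80 : ZMod 3) * fromZ (ZMod 3) (sig 1) := by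
    rw [← sig3]
    have : ∀ φ : PowerSeries ℤ, PowerSeries.map (redp (p := 3)) (fromZ _ φ) = fromZ (ZMod 3) φ := by
      intro φ; ext n; simp
    rw [this, map_mul, PowerSeries.map_C]; rfl
  rw [hψr, hz, ← map_natCast (PowerSeries.C (R := ZMod 3)), ← mul_assoc, ← map_mul] at hh
  have hd : (n' : ZMod 3) * 80 ≠ 0 := mul_ne_zero (by rwa [Ne, ZMod.natCast_eq_zero_iff]) z80
  apply no_poly (Polynomial.C ((n' : ZMod 3) * 80)⁻¹ * h)
  rw [map_mul, ← hh, Polynomial.aeval_C, show (algebraMap (ZMod 3) (PowerSeries (ZMod 3))) = PowerSeries.C from rfl,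
    ← mul_assoc, ← map_mul, inv_mul_cancel₀ hd]
  simp

end three

theorem main_all {p : ℕ} [hp : Fact p.Prime] (hodd : Odd p) (m k : ℕ) (H : PowerSeries (Rp p))
    (hH : IsMF iot k (1 + (p : PowerSeries (Rp p)) ^ (m + 1) * H)) : (p - 1) * p ^ m ∣ k := by
  by_cases h5 : 5 ≤ p
  · exact main_ge5 h5 m k H hH
  · have h2 := hp.out.two_le
    obtain ⟨t, ht⟩ := hodd
    obtain rfl : p = 3 := by omega
    exact main_3 m k H hH

end SerreCor

end

section

open UpperHalfPlane hiding I
open scoped MatrixGroups ModularForm Manifold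

namespace SerreCor

lemma to_MF {p : ℕ} [hp : Fact p.Prime] {k : ℤ} (f : ModularForm (CongruenceSubgroup.Gamma 1) k) (a : ℕ → ℚ)
    (hf : HasRationalQExpansion f a) (ha0 : a 0 ≠ 0) (m : ℕ) (y : ℕ → Rp p)
    (hy : ∀ n, 1 ≤ n → a n / a 0 = p ^ (m + 1) * (y n : ℚ)) :
    ∃ K : ℕ, k = K ∧ IsMF (iot (p := p)) K
      (1 + (p : PowerSeries (Rp p)) ^ (m + 1) * PowerSeries.mk (fun n => if n = 0 then 0 else y n)) := by
  have hM : MDiff (f : ℍ → ℂ) := f.holo'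
  have hs : ∀ γ : SL(2, ℤ), (f : ℍ → ℂ) ∣[k] γ = f := fun γ =>
    f.slash_action_eq' _ ⟨γ, by rw [CongruenceSubgroup.Gamma_one_top]; trivial, rfl⟩
  have hQ : HasQ (f : ℍ → ℂ) (PowerSeries.mk fun n => (a n : ℂ)) := by
    intro τ
    convert hf τ using 2 with n
    rw [PowerSeries.coeff_mk, Function.Periodic.qParam, ← Complex.exp_nat_mul]
    congr 2
    push_cast
    ring
  let g := mkForm k f _ hM hs hQ
  have hg : qExpansion 1 g = PowerSeries.mk fun n => (a n : ℂ) := hQ.eq hM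
  have hg0 : g ≠ 0 := by
    intro h
    rw [(ModularForm.qExpansion_eq_zero_iff one_pos one_mem_strictPeriods_SL g).2 h] at hg
    have := congrArg (PowerSeries.coeff 0) hg
    simp at this
    exact ha0 (by exact_mod_cast this.symm)
  have hk : 0 ≤ k := by
    by_contra hk
    exact hg0 (rank_zero_iff_forall_zero.mp (ModularForm.levelOne_neg_weight_rank_zero (not_le.1 hk)) g)
  obtain ⟨K, rfl⟩ := Int.eq_ofNat_of_zero_le hk
  refine ⟨K, rfl, ((a 0 : ℂ)⁻¹ • g), ?_⟩
  have hsm : qExpansion 1 ((a 0 : ℂ)⁻¹ • g) = (a 0 : ℂ)⁻¹ • qExpansion 1 g :=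
    ModularForm.qExpansion_smul one_pos one_mem_strictPeriods_SL (a 0 : ℂ)⁻¹ g
  refine hsm.trans ?_
  rw [hg]
  ext n
  have ha0' : (a 0 : ℂ) ≠ 0 := by exact_mod_cast ha0
  rw [map_add, map_one, RingHom.map_mul, RingHom.map_pow, map_natCast, map_add, PowerSeries.coeff_one,
    ← map_natCast (PowerSeries.C (R := ℂ)), ← map_pow, PowerSeries.coeff_C_mul, PowerSeries.coeff_map,
    PowerSeries.coeff_mk, PowerSeries.coeff_smul, PowerSeries.coeff_mk]
  by_cases hn : n = 0
  · subst hn; simp [ha0']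
  · rw [if_neg hn, if_neg hn, zero_add]
    have h1 := congrArg (fun x : ℚ => (x : ℂ)) (hy n (Nat.one_le_iff_ne_zero.2 hn))
    push_cast at h1
    rw [show iot (y n) = (((y n : ℚ)) : ℂ) from rfl, ← h1, smul_eq_mul]
    field_simp

end SerreCor

end

open Filter in
/-- **(Serre, Corollaire 1.)** Let `F = Σ c_n qⁿ` be a `p`-adic modular form, the limit
of level-1 modular forms `f_i` of weights `k_i` with rational `q`-expansions `a i`,
with `sup_n ‖a i n - c n‖_p → 0`.  If the `k_i` are eventually congruent mod
`(p-1)·p^m` to some residue `r ≢ 0`, then for every bound `B`, if `‖c n‖_p ≤ B` for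
all `n ≥ 1` then `‖c 0‖_p ≤ p^m·B`; i.e. `v_p(c_0) + m ≥ inf_{n≥1} v_p(c_n)`. -/
theorem serre_corollaire_1 (p : ℕ) [Fact p.Prime] (hodd : Odd p) (m : ℕ)
    (c : ℕ → ℚ_[p]) (k : ℕ → ℤ) (a : ℕ → ℕ → ℚ)
    (hmf : ∀ i : ℕ, ∃ f : ModularForm (CongruenceSubgroup.Gamma 1) (k i),
      HasRationalQExpansion f (a i))
    (hconv : ∀ ε : ℝ, 0 < ε → ∃ N : ℕ, ∀ i ≥ N, ∀ n : ℕ, ‖((a i n : ℚ_[p])) - c n‖ ≤ ε)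
    (r : ℤ) (hr : ¬ ((p : ℤ) - 1) * (p : ℤ) ^ m ∣ r)
    (hkr : ∀ᶠ i in atTop, k i ≡ r [ZMOD ((p : ℤ) - 1) * (p : ℤ) ^ m]) :
    ∀ B : ℝ, (∀ n : ℕ, 1 ≤ n → ‖c n‖ ≤ B) → ‖c 0‖ ≤ (p : ℝ) ^ m * B := by
  intro B hB
  by_contra hcon
  rw [not_le] at hcon
  have hp1 : (1 : ℝ) ≤ p := by exact_mod_cast (Fact.out : p.Prime).one_le
  have hpm : (1 : ℝ) ≤ (p : ℝ) ^ m := one_le_pow₀ hp1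
  have hB0 : 0 ≤ B := (norm_nonneg _).trans (hB 1 le_rfl)
  have hx : 0 < ‖c 0‖ := lt_of_le_of_lt (by positivity) hcon
  set x := ‖c 0‖ with hxdef
  set ε := x / (2 * (p : ℝ) ^ m) with hε
  have hε0 : 0 < ε := by positivity
  have hε1 : (p : ℝ) ^ m * ε < x := by
    rw [hε]; field_simp; linarith
  have hε2 : ε < x := lt_of_le_of_lt (le_mul_of_one_le_left hε0.le hpm) hε1
  obtain ⟨N, hN⟩ := hconv ε hε0
  obtain ⟨N', hN'⟩ := Filter.eventually_atTop.1 hkr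
  set i := max N N' with hi
  have h1 := hN i (le_max_left _ _)
  have h2 := hN' i (le_max_right _ _)
  have ha0 : ‖(a i 0 : ℚ_[p])‖ = x := by
    have h3 : ‖(a i 0 : ℚ_[p]) - c 0‖ < ‖c 0‖ := lt_of_le_of_lt (h1 0) hε2
    have h4 := IsUltrametricDist.norm_add_eq_max_of_norm_ne_norm h3.ne
    rw [sub_add_cancel, max_eq_right h3.le] at h4
    exact h4
  have ha0' : a i 0 ≠ 0 := by
    intro h
    rw [h] at ha0
    simp at ha0
    linarith
  have hn : ∀ n, 1 ≤ n → ∃ y : SerreCor.Rp p, a i n / a i 0 = p ^ (m + 1) * (y : ℚ) := by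
    intro n hn
    apply SerreCor.exists_pow_mul
    rw [Padic.norm_le_pow_iff_norm_lt_pow_add_one]
    push_cast
    rw [norm_div, ha0, div_lt_iff₀ hx]
    have h3 : ‖(a i n : ℚ_[p])‖ ≤ max ε B := by
      have h4 := IsUltrametricDist.norm_add_le_max ((a i n : ℚ_[p]) - c n) (c n)
      rw [sub_add_cancel] at h4
      exact h4.trans (max_le_max (h1 n) (hB n hn))
    refine lt_of_le_of_lt h3 ?_
    have h5 : (p : ℝ) ^ (-((m : ℤ) + 1) + 1) = ((p : ℝ) ^ m)⁻¹ := by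
      rw [show (-((m : ℤ) + 1) + 1) = -(m : ℤ) by ring, zpow_neg, zpow_natCast]
    rw [h5, inv_mul_eq_div, lt_div_iff₀ (by positivity), mul_comm]
    rcases max_choice ε B with h | h <;> rw [h] <;> assumption
  choose! y hy using hn
  obtain ⟨f, hf⟩ := hmf i
  obtain ⟨K, hK, hMF⟩ := SerreCor.to_MF f (a i) hf ha0' m y hy
  have hdvd := SerreCor.main_all hodd m K _ hMF
  apply hr
  have h6 : ((p : ℤ) - 1) * (p : ℤ) ^ m ∣ k i := by
    rw [hK]
    have := Int.natCast_dvd_natCast.2 hdvd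
    push_cast [Nat.cast_sub (Fact.out : p.Prime).one_le] at this
    exact this
  exact (Int.ModEq.dvd_iff h2).1 h6
end

section
/- Let p be an odd prime and let (k_i) be a sequence of even integers with k_i ≥ 4 for all i and k_i → ∞ in the archimedean sense. Suppose the images of the k_i in ℤ_p × ℤ/(p−1)ℤ converge to some κ ≠ 0 (equivalently, for every m the residues k_i mod (p−1)p^m are eventually constant and the limit κ is nonzero). Then the sequence of rational numbers ζ(1−k_i) = −B_{k_i}/k_i, viewed in ℚ_p, converges in ℚ_p. (Its limit is the value ζ*(1−κ) of Serre's p-adic zeta function, the constant term of the p-adic Eisenstein series G*_κ = lim_i G_{k_i}.) -/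
section
open Filter Finset

lemma aux_pow_modEq (p : ℕ) [Fact p.Prime] (m a k l : ℕ) (hk : m + 1 ≤ k) (hl : m + 1 ≤ l)
    (h : k ≡ l [MOD (p - 1) * p ^ m]) : a ^ k ≡ a ^ l [MOD p ^ (m + 1)] := by
  have hp : p.Prime := Fact.out
  wlog hkl : k ≤ l generalizing k l
  · exact (this l k hl hk h.symm (by omega)).symm
  by_cases hpa : p ∣ a
  · have h1 : ∀ n, m + 1 ≤ n → a ^ n ≡ 0 [MOD p ^ (m + 1)] := fun n hn =>
      (Nat.modEq_zero_iff_dvd).2 ((pow_dvd_pow p hn).trans (pow_dvd_pow_of_dvd hpa n))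
    exact (h1 k hk).trans (h1 l hl).symm
  · obtain ⟨t, ht⟩ := (Nat.modEq_iff_dvd' hkl).1 h
    have hco : Nat.Coprime a (p ^ (m + 1)) :=
      (((Nat.Prime.coprime_iff_not_dvd hp).2 hpa).symm).pow_right _
    have h2 := Nat.ModEq.pow_totient hco
    rw [Nat.totient_prime_pow_succ hp, mul_comm] at h2
    have h3 : l = k + (p - 1) * p ^ m * t := by omega
    have h4 := ((h2.pow t).mul_left (a ^ k))
    rw [← pow_mul, ← pow_add, ← h3] at h4
    simpa using h4.symm

lemma aux_norm_sub (p : ℕ) [Fact p.Prime] (m a b : ℕ) (h : a ≡ b [MOD p ^ m]) :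
    ‖(a : ℚ_[p]) - b‖ ≤ (p : ℝ) ^ (-(m : ℤ)) := by
  have h1 := (Nat.modEq_iff_dvd).1 h.symm
  have := (Padic.norm_int_le_pow_iff_dvd (p := p) ((a : ℤ) - b) m).2 (by exact_mod_cast h1)
  simpa using this

lemma aux_p_tendsto (p : ℕ) [Fact p.Prime] :
    Tendsto (fun n : ℕ => (p : ℚ_[p]) ^ n) atTop (nhds 0) :=
  tendsto_pow_atTop_nhds_zero_of_norm_lt_one Padic.norm_p_lt_one

lemma aux_bern (p : ℕ) [Fact p.Prime] (k : ℕ) :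
    Tendsto (fun n : ℕ => (∑ a ∈ range (p ^ n), (a : ℚ_[p]) ^ k) / (p : ℚ_[p]) ^ n) atTop
      (nhds ((bernoulli k : ℚ) : ℚ_[p])) := by
  have hp : (p : ℚ_[p]) ≠ 0 := by exact_mod_cast (Fact.out : p.Prime).ne_zero
  have key : ∀ n : ℕ, (∑ a ∈ range (p ^ n), (a : ℚ_[p]) ^ k) / (p : ℚ_[p]) ^ n =
      ∑ i ∈ range k, ((bernoulli i : ℚ) : ℚ_[p]) * ((k + 1).choose i) *
        ((p : ℚ_[p]) ^ n) ^ (k - i) / (k + 1) + ((bernoulli k : ℚ) : ℚ_[p]) := by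
    intro n
    have h := congrArg (fun x : ℚ => (x : ℚ_[p])) (sum_range_pow (p ^ n) k)
    push_cast at h
    rw [h, sum_range_succ, add_div, sum_div]
    have hk1 : (k + 1 : ℚ_[p]) ≠ 0 := by exact_mod_cast k.succ_ne_zero
    congr 1
    · apply sum_congr rfl
      intro i hi
      have : k + 1 - i = (k - i) + 1 := by have := mem_range.1 hi; omega
      rw [this, pow_succ]
      field_simp
    · simp
      field_simp
  simp_rw [key]
  conv => rhs; rw [← zero_add ((bernoulli k : ℚ) : ℚ_[p])]
  apply Tendsto.add_const
  rw [← sum_const_zero (s := range k)]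
  apply tendsto_finsetSum
  intro i hi
  have h1 := ((aux_p_tendsto p).pow (k - i))
  rw [zero_pow (by have := mem_range.1 hi; omega)] at h1
  simpa using (h1.const_mul (((bernoulli i : ℚ) : ℚ_[p]) * ((k + 1).choose i))).div_const (k + 1 : ℚ_[p])

lemma aux_perm (c N k : ℕ) (hN : 0 < N) (hc : Nat.Coprime N c) :
    ∑ a ∈ range N, (c * a % N) ^ k = ∑ a ∈ range N, a ^ k := by
  have hm : Set.MapsTo (fun a => c * a % N) (range N) (range N) := by
    intro a _; simpa using Nat.mod_lt _ hN
  have hi : Set.InjOn (fun a => c * a % N) (range N : Set ℕ) := by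
    intro a ha b hb hab
    have h1 : a ≡ b [MOD N] := Nat.ModEq.cancel_left_of_coprime hc hab
    have ha := mem_range.1 (mem_coe.1 ha)
    have hb := mem_range.1 (mem_coe.1 hb)
    exact Nat.ModEq.eq_of_lt_of_lt h1 ha hb
  exact sum_nbij (fun a => c * a % N) hm hi
    (surjOn_of_injOn_of_card_le _ hm hi le_rfl) (fun _ _ => rfl)

lemma aux_exp (c N k : ℕ) (hN : 0 < N) (hc : Nat.Coprime N c) :
    ∃ Z : ℕ, c ^ k * ∑ a ∈ range N, a ^ k = ∑ a ∈ range N, a ^ k +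
      k * N * (∑ a ∈ range N, (c * a / N) * (c * a % N) ^ (k - 1)) + N ^ 2 * Z := by
  refine ⟨∑ a ∈ range N, (Polynomial.powAddExpansion (c * a % N) (N * (c * a / N)) k).1 * (c * a / N) ^ 2, ?_⟩
  conv_rhs => rw [← aux_perm c N k hN hc]
  rw [mul_sum, mul_sum, mul_sum, ← sum_add_distrib, ← sum_add_distrib]
  apply sum_congr rfl
  intro a _
  have h := (Polynomial.powAddExpansion (c * a % N) (N * (c * a / N)) k).2
  have h2 := Nat.mod_add_div (c * a) N
  rw [← mul_pow, show (c * a) ^ k = (c * a % N + N * (c * a / N)) ^ k by rw [h2]]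
  refine h.trans ?_
  push_cast
  ring

lemma aux_riemann (p : ℕ) [Fact p.Prime] (c k : ℕ) (hk : k ≠ 0) (hc : Nat.Coprime p c) :
    Tendsto (fun n : ℕ => ((∑ a ∈ range (p ^ n), (c * a / p ^ n) * (c * a % p ^ n) ^ (k - 1) : ℕ) : ℚ_[p]))
      atTop (nhds (((c : ℚ_[p]) ^ k - 1) * (bernoulli k : ℚ) / k)) := by
  have hp : (p : ℚ_[p]) ≠ 0 := by exact_mod_cast (Fact.out : p.Prime).ne_zero
  have hk' : (k : ℚ_[p]) ≠ 0 := by exact_mod_cast hk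
  have h0 : ∀ n : ℕ, 0 < p ^ n := fun n => pow_pos (Fact.out : p.Prime).pos n
  choose Z hZ using fun n : ℕ => aux_exp c (p ^ n) k (h0 n) (hc.pow_left n)
  have hz : Tendsto (fun n : ℕ => (p : ℚ_[p]) ^ n * (Z n : ℚ_[p])) atTop (nhds 0) := by
    apply squeeze_zero_norm (a := fun n => ‖(p : ℚ_[p]) ^ n‖)
    · intro n
      rw [norm_mul]
      have : ‖(Z n : ℚ_[p])‖ ≤ 1 := by simpa using Padic.norm_int_le_one (p := p) (Z n : ℤ)
      exact mul_le_of_le_one_right (norm_nonneg _) this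
    · simpa using (aux_p_tendsto p).norm
  have h1 := (((aux_bern p k).const_mul ((c : ℚ_[p]) ^ k - 1)).sub hz).div_const (k : ℚ_[p])
  rw [sub_zero] at h1
  refine h1.congr ?_
  intro n
  have h := congrArg (fun x : ℕ => (x : ℚ_[p])) (hZ n)
  simp only [Nat.cast_add, Nat.cast_mul, Nat.cast_pow, Nat.cast_sum] at h ⊢
  field_simp
  linear_combination h

lemma aux_kummer (p : ℕ) [Fact p.Prime] (m c k l : ℕ) (hc : Nat.Coprime p c)
    (hk : m + 2 ≤ k) (hl : m + 2 ≤ l)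
    (h : k ≡ l [MOD (p - 1) * p ^ m]) :
    ‖((c : ℚ_[p]) ^ k - 1) * (bernoulli k : ℚ) / k - ((c : ℚ_[p]) ^ l - 1) * (bernoulli l : ℚ) / l‖
      ≤ (p : ℝ) ^ (-((m + 1 : ℕ) : ℤ)) := by
  have h1 := ((aux_riemann p c k (by omega) hc).sub (aux_riemann p c l (by omega) hc)).norm
  refine le_of_tendsto h1 (Eventually.of_forall fun n => ?_)
  apply aux_norm_sub
  have h' : k - 1 ≡ l - 1 [MOD (p - 1) * p ^ m] := by
    apply Nat.ModEq.add_right_cancel' 1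
    rwa [Nat.sub_add_cancel (by omega), Nat.sub_add_cancel (by omega)]
  apply Nat.ModEq.sum
  intro a _
  exact (aux_pow_modEq p m _ _ _ (by omega) (by omega) h').mul_left _

lemma aux_tail (p : ℕ) [Fact p.Prime] (k : ℕ → ℕ) (harch : Tendsto k atTop atTop)
    (κ : ℤ_[p] × ZMod (p - 1))
    (hκ1 : Tendsto (fun i => ((k i : ℤ_[p]))) atTop (nhds κ.1))
    (hκ2 : ∀ᶠ i in atTop, ((k i : ZMod (p - 1))) = κ.2) (m : ℕ) :
    ∃ I, ∀ i ≥ I, m + 2 ≤ k i ∧ ∀ j ≥ I, k i ≡ k j [MOD (p - 1) * p ^ m] := by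
  have hp : p.Prime := Fact.out
  have hpos : (0 : ℝ) < (p : ℝ) ^ (-(m : ℤ)) := zpow_pos (by exact_mod_cast hp.pos) _
  obtain ⟨I1, h1⟩ := (Metric.cauchySeq_iff.1 hκ1.cauchySeq) _ hpos
  obtain ⟨I2, h2⟩ := eventually_atTop.1 hκ2
  obtain ⟨I3, h3⟩ := eventually_atTop.1 (harch.eventually_ge_atTop (m + 2))
  refine ⟨max I1 (max I2 I3), fun i hi => ⟨h3 i (by omega), fun j hj => ?_⟩⟩
  have hco : Nat.Coprime (p - 1) (p ^ m) := by
    apply Nat.Coprime.pow_right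
    have := Nat.coprime_self_sub_right (m := 1) (n := p) hp.one_lt.le
    exact (this.2 (by simp)).symm
  rw [← Nat.modEq_and_modEq_iff_modEq_mul hco]
  constructor
  · rw [← ZMod.natCast_eq_natCast_iff, h2 i (by omega), h2 j (by omega)]
  · have h := (h1 j (by omega) i (by omega)).le
    rw [dist_eq_norm] at h
    rw [Nat.modEq_iff_dvd]
    have := (PadicInt.norm_int_le_pow_iff_dvd (p := p) (k := (k j : ℤ) - k i) (n := m)).1 (by simpa using h)
    exact_mod_cast this

lemma aux_c (p : ℕ) [Fact p.Prime] (hodd : Odd p) (k : ℕ → ℕ)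
    (κ : ℤ_[p] × ZMod (p - 1)) (hκ : κ ≠ 0)
    (hκ1 : Tendsto (fun i => ((k i : ℤ_[p]))) atTop (nhds κ.1))
    (hκ2 : ∀ᶠ i in atTop, ((k i : ZMod (p - 1))) = κ.2) :
    ∃ c M : ℕ, Nat.Coprime p c ∧ ∀ᶠ i in atTop, ¬ ((p ^ M : ℕ) : ℤ) ∣ (c : ℤ) ^ k i - 1 := by
  have hp : p.Prime := Fact.out
  by_cases h2 : κ.2 = 0
  · have h1 : κ.1 ≠ 0 := fun h => hκ (Prod.ext h h2)
    have hn : 0 < ‖κ.1‖ := norm_pos_iff.2 h1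
    obtain ⟨M, hM⟩ := PadicInt.exists_pow_neg_lt p hn
    refine ⟨1 + p, M + 1, by simp, ?_⟩
    filter_upwards [hκ1.norm.eventually (lt_mem_nhds hM)] with i hi hd
    have h3 : ¬ ((p ^ M : ℕ) : ℤ) ∣ (k i : ℤ) := by
      intro h
      have := (PadicInt.norm_int_le_pow_iff_dvd (p := p) (k := (k i : ℤ)) (n := M)).2 (by exact_mod_cast h)
      rw [Int.cast_natCast] at this
      exact absurd hi (not_lt.2 this)
    apply h3
    have h4 := Int.emultiplicity_pow_sub_pow (p := p) hp hodd (x := ((1 + p : ℕ) : ℤ)) (y := 1)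
      (by simp) (by
        intro h
        have : p ∣ 1 + p := by exact_mod_cast h
        have : p ∣ 1 := by simpa using this
        exact hp.one_lt.ne' (Nat.dvd_one.1 this)) (k i)
    have h5 : ((1 + p : ℕ) : ℤ) - 1 = p := by push_cast; ring
    have h6 : emultiplicity (p : ℤ) (p : ℤ) = 1 := by
      rw [Int.natCast_emultiplicity]
      exact (Nat.finiteMultiplicity_iff.2 ⟨hp.ne_one, hp.pos⟩).emultiplicity_self
    rw [h5, h6, one_pow] at h4
    have h7 := le_emultiplicity_of_pow_dvd (a := (p : ℤ)) (b := ((1 + p : ℕ) : ℤ) ^ k i - 1) (k := M + 1)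
      (by rw [Nat.cast_pow] at hd; exact hd)
    rw [h4, add_comm 1] at h7
    have h8 : (M : ℕ∞) ≤ emultiplicity p (k i) := by
      push_cast at h7
      exact (ENat.add_le_add_iff_right ENat.one_ne_top).1 h7
    exact_mod_cast pow_dvd_of_le_emultiplicity h8
  · obtain ⟨g, hg⟩ := IsCyclic.exists_generator (α := (ZMod p)ˣ)
    refine ⟨(g : ZMod p).val, 1, (ZMod.val_coe_unit_coprime g).symm, ?_⟩
    filter_upwards [hκ2] with i hi hd
    apply h2
    rw [← hi, ZMod.natCast_eq_zero_iff]
    have ho : orderOf g = p - 1 := by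
      rw [orderOf_eq_card_of_forall_mem_zpowers hg, Nat.card_eq_fintype_card, ZMod.card_units]
    rw [← ho]
    apply orderOf_dvd_of_pow_eq_one
    rw [pow_one, ← ZMod.intCast_zmod_eq_zero_iff_dvd] at hd
    ext
    push_cast at hd ⊢
    rw [ZMod.natCast_zmod_val] at hd
    exact sub_eq_zero.1 hd

lemma aux_cauchy (p : ℕ) [Fact p.Prime] (u : ℕ → ℚ_[p])
    (h : ∀ m : ℕ, ∃ I, ∀ i ≥ I, ∀ j ≥ I, ‖u i - u j‖ ≤ (p : ℝ) ^ (-((m + 1 : ℕ) : ℤ))) :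
    ∃ L, Tendsto u atTop (nhds L) := by
  apply cauchySeq_tendsto_of_complete
  rw [Metric.cauchySeq_iff]
  intro ε hε
  obtain ⟨m, hm⟩ := PadicInt.exists_pow_neg_lt p hε
  obtain ⟨I, hI⟩ := h m
  refine ⟨I, fun i hi j hj => ?_⟩
  rw [dist_eq_norm]
  refine (hI i hi j hj).trans_lt (lt_of_le_of_lt ?_ hm)
  exact zpow_le_zpow_right₀ (by exact_mod_cast (Fact.out : p.Prime).one_lt.le) (by push_cast; omega)

end


open Filter in
/-- Let `p` be an odd prime and `(k_i)` a sequence of even integers `≥ 4` tending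
archimedean-ly to infinity, whose images in `X = ℤ_p × ℤ/(p-1)ℤ` converge to some
`κ ≠ 0`.  Then the rational numbers `ζ(1-k_i) = -B_{k_i}/k_i`, viewed in `ℚ_p`,
converge in `ℚ_p` (to the value `ζ*(1-κ)` of Serre's `p`-adic zeta function). -/
theorem zeta_values_converge_p_adically (p : ℕ) [Fact p.Prime] (hodd : Odd p)
    (k : ℕ → ℕ) (hk4 : ∀ i, 4 ≤ k i) (hke : ∀ i, Even (k i))
    (harch : Tendsto k atTop atTop)
    (κ : ℤ_[p] × ZMod (p - 1)) (hκ : κ ≠ 0)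
    (hκ1 : Tendsto (fun i => ((k i : ℤ_[p]))) atTop (nhds κ.1))
    (hκ2 : ∀ᶠ i in atTop, ((k i : ZMod (p - 1))) = κ.2) :
    ∃ L : ℚ_[p],
      Tendsto (fun i => (((-(bernoulli (k i)) / (k i) : ℚ)) : ℚ_[p])) atTop (nhds L) := by
  obtain ⟨c, M, hc, hcM⟩ := aux_c p hodd k κ hκ hκ1 hκ2
  obtain ⟨A, hA⟩ := aux_cauchy p
    (fun i => ((c : ℚ_[p]) ^ k i - 1) * (bernoulli (k i) : ℚ) / k i) (fun m => by
      obtain ⟨I, hI⟩ := aux_tail p k harch κ hκ1 hκ2 m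
      exact ⟨I, fun i hi j hj => aux_kummer p m c _ _ hc (hI i hi).1 (hI j hj).1 ((hI i hi).2 j hj)⟩)
  obtain ⟨C, hC⟩ := aux_cauchy p (fun i => (c : ℚ_[p]) ^ k i) (fun m => by
      obtain ⟨I, hI⟩ := aux_tail p k harch κ hκ1 hκ2 m
      refine ⟨I, fun i hi j hj => ?_⟩
      have h1 := (hI i hi).1
      have h2 := (hI j hj).1
      simpa using aux_norm_sub p (m + 1) _ _
        (aux_pow_modEq p m c _ _ (by omega) (by omega) ((hI i hi).2 j hj)))
  have hC1 := hC.sub_const 1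
  have hlow : ∀ᶠ i in atTop, (p : ℝ) ^ (-(M : ℤ)) ≤ ‖(c : ℚ_[p]) ^ k i - 1‖ := by
    filter_upwards [hcM] with i hi
    by_contra hlt
    apply hi
    have := (Padic.norm_int_le_pow_iff_dvd (p := p) ((c : ℤ) ^ k i - 1) M).1
      (by push_cast; exact (not_le.1 hlt).le)
    exact_mod_cast this
  have hpos : (0 : ℝ) < (p : ℝ) ^ (-(M : ℤ)) :=
    zpow_pos (by exact_mod_cast (Fact.out : p.Prime).pos) _
  have hne : C - 1 ≠ 0 := norm_pos_iff.1 (hpos.trans_le (ge_of_tendsto hC1.norm hlow))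
  refine ⟨-(A / (C - 1)), ((hA.div hC1 hne).neg).congr' ?_⟩
  filter_upwards [hlow] with i hi
  have h0 : (c : ℚ_[p]) ^ k i - 1 ≠ 0 := norm_pos_iff.1 (hpos.trans_le hi)
  have hk0 : (k i : ℚ_[p]) ≠ 0 := by
    have := hk4 i
    exact_mod_cast (by omega : k i ≠ 0)
  simp only [Pi.div_apply]
  push_cast
  field_simp
end

section
/- (Abstract Kummer congruences; Katz) Let p be a prime, let K be a field complete with respect to a nontrivial nonarchimedean absolute value ‖·‖, equipped with a ℚ_p-algebra structure such that ‖·‖ restricts to the p-adic absolute value on ℚ_p (normalized by ‖p‖ = p^{-1}), and let 𝒪 = {x ∈ K : ‖x‖ ≤ 1} be its valuation ring. Let Y be a compact Hausdorff totally disconnected topological space, let I be an index type, let (f_i)_{i∈I} be a family of continuous functions Y → K with sup_{y∈Y} ‖f_i(y)‖ ≤ 1 for every i, and assume the K-linear span of the f_i is dense in C(Y, K) for the sup norm. Let (a_i)_{i∈I} be a family of elements of 𝒪. Then the following are equivalent: (1) there exists a K-linear map μ : C(Y, K) → K with ‖μ(f)‖ ≤ sup_{y∈Y} ‖f(y)‖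 for all f (an 𝒪-valued measure on Y) such that μ(f_i) = a_i for all i ∈ I; (2) the abstract Kummer congruences hold: for every finitely supported family (b_i)_{i∈I} of elements of K and every natural number n, if ‖Σ_i b_i·f_i(y)‖ ≤ p^{-n} for all y ∈ Y, then ‖Σ_i b_i·a_i‖ ≤ p^{-n}. -/
/-- **Abstract Kummer congruences (Katz, Proposition (4.0.6)).**  Let `K` be a complete
nonarchimedean valued `ℚ_p`-algebra field whose norm extends the `p`-adic one, with
valuation ring `𝒪 = {x : ‖x‖ ≤ 1}`, and let `Y` be a compact, Hausdorff, totally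
disconnected space.  Given continuous functions `f i : Y → K` of sup-norm `≤ 1` whose
`K`-span is dense in `C(Y, K)`, and elements `a i ∈ 𝒪`, there exists an `𝒪`-valued
measure `μ` on `Y` (a `K`-linear functional of operator norm `≤ 1`) with `μ(f i) = a i`
for all `i` if and only if the abstract Kummer congruences hold: for every finitely
supported family `(b i)` in `K` and every `n : ℕ`, if `‖Σ b i·f i(y)‖ ≤ p⁻ⁿ` for all
`y ∈ Y` then `‖Σ b i·a i‖ ≤ p⁻ⁿ`. -/
theorem abstract_kummer_congruences
    (p : ℕ) [Fact p.Prime]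
    (K : Type*) [NontriviallyNormedField K] [CompleteSpace K] [IsUltrametricDist K]
    [Algebra ℚ_[p] K] (hK : ∀ x : ℚ_[p], ‖algebraMap ℚ_[p] K x‖ = ‖x‖)
    (Y : Type*) [TopologicalSpace Y] [CompactSpace Y] [T2Space Y]
    [TotallyDisconnectedSpace Y]
    (I : Type*) (f : I → C(Y, K)) (hf1 : ∀ i, ∀ y : Y, ‖f i y‖ ≤ 1)
    (hdense : Dense (Submodule.span K (Set.range f) : Set C(Y, K)))
    (a : I → K) (ha : ∀ i, ‖a i‖ ≤ 1) :
    (∃ μ : C(Y, K) →ₗ[K] K,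
        (∀ g : C(Y, K), ‖μ g‖ ≤ ‖g‖) ∧ ∀ i, μ (f i) = a i) ↔
      (∀ (b : I →₀ K) (n : ℕ),
        (∀ y : Y, ‖∑ i ∈ b.support, b i * f i y‖ ≤ (p : ℝ) ^ (-(n : ℤ))) →
        ‖∑ i ∈ b.support, b i * a i‖ ≤ (p : ℝ) ^ (-(n : ℤ))) := by
  have hp1 : (1 : ℝ) < p := by exact_mod_cast (Fact.out : p.Prime).one_lt
  have hp0 : (0 : ℝ) < p := by linarith
  have hFa : ∀ (b : I →₀ K) (y : Y),
      (Finsupp.linearCombination K f b) y = ∑ i ∈ b.support, b i * f i y := by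
    intro b y
    simp [Finsupp.linearCombination_apply, Finsupp.sum, ContinuousMap.sum_apply]
  have hA : ∀ (b : I →₀ K),
      Finsupp.linearCombination K a b = ∑ i ∈ b.support, b i * a i := by
    intro b
    simp [Finsupp.linearCombination_apply, Finsupp.sum]
  constructor
  · rintro ⟨μ, hμ, hμf⟩ b n hb
    have h1 : μ (Finsupp.linearCombination K f b) = ∑ i ∈ b.support, b i * a i := by
      simp [Finsupp.linearCombination_apply, Finsupp.sum, map_sum, hμf]
    rw [← h1]
    refine (hμ _).trans ((ContinuousMap.norm_le _ (by positivity)).2 fun y => ?_)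
    rw [hFa]
    exact hb y
  · intro h
    have h' : ∀ (b : I →₀ K) (n : ℕ), ‖Finsupp.linearCombination K f b‖ ≤ (p : ℝ) ^ (-(n : ℤ)) →
        ‖Finsupp.linearCombination K a b‖ ≤ (p : ℝ) ^ (-(n : ℤ)) := by
      intro b n hb
      rw [hA]
      apply h b n
      intro y
      rw [← hFa]
      exact (ContinuousMap.norm_coe_le_norm _ y).trans hb
    have key : ∀ b : I →₀ K, ‖Finsupp.linearCombination K a b‖ ≤
        1 * ‖Finsupp.linearCombination K f b‖ := by
      intro b
      rw [one_mul]
      by_cases h0 : Finsupp.linearCombination K f b = 0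
      · rw [h0, norm_zero]
        refine le_of_forall_pos_le_add fun ε hε => ?_
        obtain ⟨n, hn⟩ := exists_pow_lt_of_lt_one hε (inv_lt_one_of_one_lt₀ hp1)
        have := h' b n (by rw [h0, norm_zero]; positivity)
        rw [zpow_neg, zpow_natCast, ← inv_pow] at this
        linarith
      · set g := Finsupp.linearCombination K f b with hg
        have hne : Nonempty Y := by
          by_contra hY
          rw [not_nonempty_iff] at hY
          exact h0 (ContinuousMap.ext fun y => hY.elim y)
        obtain ⟨y, hy⟩ : ∃ y, ∀ z, ‖g z‖ ≤ ‖g y‖ := by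
          obtain ⟨y, -, hy⟩ := isCompact_univ.exists_isMaxOn (f := fun z => ‖g z‖)
            Set.univ_nonempty (by fun_prop)
          exact ⟨y, fun z => hy (Set.mem_univ z)⟩
        have hgy : ‖g‖ = ‖g y‖ :=
          le_antisymm ((ContinuousMap.norm_le _ (norm_nonneg _)).2 hy)
            (ContinuousMap.norm_coe_le_norm _ y)
        have hpos : 0 < ‖g y‖ := hgy ▸ norm_pos_iff.2 h0
        have := h' ((g y)⁻¹ • b) 0 (by
          rw [map_smul, norm_smul, ← hg, hgy, norm_inv, inv_mul_cancel₀ hpos.ne']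
          simp)
        rw [map_smul, norm_smul, norm_inv] at this
        simp only [Nat.cast_zero, neg_zero, zpow_zero] at this
        rw [inv_mul_le_iff₀ hpos, mul_one] at this
        rw [hgy]
        exact this
    have hd : DenseRange (Finsupp.linearCombination K f) := by
      rw [DenseRange, ← LinearMap.coe_range, Finsupp.range_linearCombination]
      exact hdense
    refine ⟨((Finsupp.linearCombination K a).extendOfNorm
      (Finsupp.linearCombination K f)).toLinearMap, fun g => ?_, fun i => ?_⟩
    · simpa using LinearMap.norm_extendOfNorm_apply_le hd 1 key g
    · simpa using LinearMap.extendOfNorm_eq hd ⟨1, key⟩ (Finsupp.single i 1)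
end
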